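/- arXiv:2601.19126 — 12 statements merged into one kernel-verified Lean document; each statement's English description precedes it below -/
import Mathlib

section
/- Let N ≥ 1 and let μ : Fin N → ℝ satisfy μ j ≥ 0 for all j. Let μmax = max_j μ j and let d be the number of indices j with μ j = μmax. If s is a real number with 0 ≤ s ≤ log d, then the supremum of Σ_j μ j * λ j over all λ ∈ Δ_N with H(λ) ≥ s equals μmax, and it is attained by the vector λ* that assigns weight 1/d to each of the d indices attaining μmax and 0 elsewhere. -/
open scoped Classical

/-- low-entanglement regime of the maximal privacy energy `J_max`
(Theorem 4(i)): for `0 ≤ s ≤ log d` the entropy-constrained linear maximization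
over the simplex equals `μmax`, attained by the uniform weights on the
maximizing indices. -/
theorem stmt0 (N : ℕ) (hN : 1 ≤ N) (μ : Fin N → ℝ) (hμ : ∀ j, 0 ≤ μ j)
    (μmax : ℝ) (hmax : IsGreatest (Set.range μ) μmax)
    (d : ℕ) (hd : d = (Finset.univ.filter (fun j => μ j = μmax)).card)
    (s : ℝ) (hs0 : 0 ≤ s) (hs1 : s ≤ Real.log d) :
    (∀ lam : Fin N → ℝ, (∀ j, 0 ≤ lam j) → (∑ j, lam j) = 1 →
        s ≤ ∑ j, Real.negMulLog (lam j) → (∑ j, μ j * lam j) ≤ μmax) ∧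
    (∀ j, 0 ≤ (if μ j = μmax then (1 : ℝ) / d else 0)) ∧
    (∑ j, (if μ j = μmax then (1 : ℝ) / d else 0)) = 1 ∧
    s ≤ (∑ j, Real.negMulLog (if μ j = μmax then (1 : ℝ) / d else 0)) ∧
    (∑ j, μ j * (if μ j = μmax then (1 : ℝ) / d else 0)) = μmax := by
  have hd_pos : 0 < d := by
    obtain ⟨j, hj⟩ := hmax.1
    rw [hd, Finset.card_pos]
    exact ⟨j, by simp [hj]⟩
  have hd_ne : (d : ℝ) ≠ 0 := by exact_mod_cast hd_pos.ne'
  have sum_ite (c : ℝ) : ∑ j, (if μ j = μmax then c else 0) = d * c := by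
    rw [← Finset.sum_filter, Finset.sum_const, ← hd, nsmul_eq_mul]
  refine ⟨fun lam hlam hsum _ => ?_, fun j => ?_, ?_, ?_, ?_⟩
  · calc ∑ j, μ j * lam j ≤ ∑ j, μmax * lam j :=
          Finset.sum_le_sum fun j _ =>
            mul_le_mul_of_nonneg_right (hmax.2 ⟨j, rfl⟩) (hlam j)
      _ = μmax := by rw [← Finset.mul_sum, hsum, mul_one]
  · split_ifs <;> positivity
  · rw [sum_ite]
    field_simp
  · simp only [apply_ite Real.negMulLog, Real.negMulLog_zero]
    rw [sum_ite]
    refine hs1.trans_eq ?_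
    rw [Real.negMulLog, one_div, Real.log_inv]
    field_simp
  · have h (j : Fin N) : μ j * (if μ j = μmax then (1 : ℝ) / d else 0) =
        if μ j = μmax then μmax * (1 / d) else 0 := by
      split_ifs with hj
      · rw [hj]
      · rw [mul_zero]
    simp only [h]
    rw [sum_ite]
    field_simp
end

section
/- Let N ≥ 1 and let μ : Fin N → ℝ satisfy μ j ≥ 0 for all j, and assume μ is not constant. Let μmax = max_j μ j and let d be the number of indices j with μ j = μmax. Then for every real s with log d < s < log N there exists a unique γ > 0 satisfying the entropy equation log Z(γ) − (γ / Z(γ)) * Σ_j μ j * exp(γ * μ j) = s, where Z(γ) = Σ_j exp(γ * μ j). -/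
open scoped Classical

/-- The entropy of the Gibbs distribution with weights proportional to `exp (γ * μ j)`. -/
noncomputable def gibbsEntropy {ι : Type*} [Fintype ι] (μ : ι → ℝ) (γ : ℝ) : ℝ :=
  Real.log (∑ j, Real.exp (γ * μ j)) -
    (γ / (∑ j, Real.exp (γ * μ j))) * (∑ j, μ j * Real.exp (γ * μ j))

section GibbsEntropy

variable {ι : Type*} [Fintype ι]

lemma sum_exp_mul_pos [Nonempty ι] (μ : ι → ℝ) (γ : ℝ) : 0 < ∑ j, Real.exp (γ * μ j) :=
  Finset.sum_pos (fun _ _ => Real.exp_pos _) Finset.univ_nonempty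

lemma hasDerivAt_sum_mul_exp (a μ : ι → ℝ) (γ : ℝ) :
    HasDerivAt (fun γ => ∑ j, a j * Real.exp (γ * μ j))
      (∑ j, a j * μ j * Real.exp (γ * μ j)) γ := by
  refine HasDerivAt.fun_sum fun j _ => ?_
  have h := (((hasDerivAt_id γ).mul_const (μ j)).exp).const_mul (a j)
  refine h.congr_deriv ?_
  simp only [id]
  ring

/-- Strict Cauchy–Schwarz inequality for a weighted second moment. -/
lemma sq_sum_mul_lt_of_ne (μ w : ι → ℝ) (hw : ∀ j, 0 < w j) (hnc : ∃ i j, μ i ≠ μ j) :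
    (∑ j, μ j * w j) ^ 2 < (∑ j, μ j * μ j * w j) * ∑ j, w j := by
  obtain ⟨i, k, hik⟩ := hnc
  have hZ : 0 < ∑ j, w j := Finset.sum_pos (fun j _ => hw j) ⟨i, Finset.mem_univ i⟩
  set Z := ∑ j, w j with hZdef
  set M := ∑ j, μ j * w j with hM
  set Q := ∑ j, μ j * μ j * w j with hQ
  have key : ∑ j, w j * (Z * μ j - M) ^ 2 = Z * (Q * Z - M ^ 2) := by
    have expand : ∑ j, w j * (Z * μ j - M) ^ 2 = Z ^ 2 * Q - 2 * Z * M * M + M ^ 2 * Z := by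
      calc ∑ j, w j * (Z * μ j - M) ^ 2
          = ∑ j, (Z ^ 2 * (μ j * μ j * w j) - 2 * Z * M * (μ j * w j) + M ^ 2 * w j) :=
            Finset.sum_congr rfl fun j _ => by ring
        _ = Z ^ 2 * Q - 2 * Z * M * M + M ^ 2 * Z := by
            rw [Finset.sum_add_distrib, Finset.sum_sub_distrib, ← Finset.mul_sum,
              ← Finset.mul_sum, ← Finset.mul_sum]
    rw [expand]; ring
  have hpos : 0 < ∑ j, w j * (Z * μ j - M) ^ 2 := by
    obtain ⟨l, hl⟩ : ∃ l, Z * μ l - M ≠ 0 := by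
      by_contra! h
      exact hik (mul_left_cancel₀ hZ.ne' (by linarith [h i, h k]))
    exact Finset.sum_pos' (fun j _ => mul_nonneg (hw j).le (sq_nonneg _))
      ⟨l, Finset.mem_univ l, mul_pos (hw l) (by positivity)⟩
  rw [key] at hpos
  linarith [(mul_pos_iff_of_pos_left hZ).1 hpos]

lemma hasDerivAt_gibbsEntropy [Nonempty ι] (μ : ι → ℝ) (γ : ℝ) :
    HasDerivAt (gibbsEntropy μ)
      (-γ * ((∑ j, μ j * μ j * Real.exp (γ * μ j)) * (∑ j, Real.exp (γ * μ j)) -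
        (∑ j, μ j * Real.exp (γ * μ j)) ^ 2) / (∑ j, Real.exp (γ * μ j)) ^ 2) γ := by
  have hZ := sum_exp_mul_pos μ γ
  have hZ' : HasDerivAt (fun γ => ∑ j, Real.exp (γ * μ j))
      (∑ j, μ j * Real.exp (γ * μ j)) γ := by
    simpa using hasDerivAt_sum_mul_exp (fun _ => 1) μ γ
  have h := (hZ'.log hZ.ne').sub
    (((hasDerivAt_id γ).div hZ' hZ.ne').mul (hasDerivAt_sum_mul_exp μ μ γ))
  refine h.congr_deriv ?_
  simp only [id, Pi.div_apply]
  generalize ∑ j, Real.exp (γ * μ j) = Z at hZ ⊢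
  generalize ∑ j, μ j * Real.exp (γ * μ j) = M
  field_simp
  ring

lemma strictAntiOn_gibbsEntropy (μ : ι → ℝ) (hnc : ∃ i j, μ i ≠ μ j) :
    StrictAntiOn (gibbsEntropy μ) (Set.Ici 0) := by
  have : Nonempty ι := hnc.nonempty
  refine strictAntiOn_of_deriv_neg (convex_Ici 0)
    (fun γ _ => (hasDerivAt_gibbsEntropy μ γ).continuousAt.continuousWithinAt) fun γ hγ => ?_
  rw [interior_Ici, Set.mem_Ioi] at hγ
  rw [(hasDerivAt_gibbsEntropy μ γ).deriv]
  have hvar := sub_pos.2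
    (sq_sum_mul_lt_of_ne μ (fun j => Real.exp (γ * μ j)) (fun _ => Real.exp_pos _) hnc)
  refine div_neg_of_neg_of_pos ?_ (pow_pos (sum_exp_mul_pos μ γ) 2)
  exact mul_neg_of_neg_of_pos (neg_neg_of_pos hγ) hvar

lemma gibbsEntropy_sub_const [Nonempty ι] (μ : ι → ℝ) (c γ : ℝ) :
    gibbsEntropy (fun j => μ j - c) γ = gibbsEntropy μ γ := by
  have hZ := sum_exp_mul_pos μ γ
  have hE := Real.exp_pos (-(γ * c))
  have hexp : ∀ j, Real.exp (γ * (μ j - c)) = Real.exp (-(γ * c)) * Real.exp (γ * μ j) :=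
    fun j => by rw [← Real.exp_add]; ring_nf
  have hM : ∑ j, (μ j - c) * (Real.exp (-(γ * c)) * Real.exp (γ * μ j)) =
      Real.exp (-(γ * c)) * (∑ j, μ j * Real.exp (γ * μ j) - c * ∑ j, Real.exp (γ * μ j)) := by
    rw [Finset.mul_sum (a := c), ← Finset.sum_sub_distrib, Finset.mul_sum]
    exact Finset.sum_congr rfl fun j _ => by ring
  simp only [gibbsEntropy, hexp]
  rw [hM, ← Finset.mul_sum, Real.log_mul hE.ne' hZ.ne', Real.log_exp]
  field_simp
  ring

lemma tendsto_gibbsEntropy_atTop (μ : ι → ℝ) {m : ℝ} (hm : IsGreatest (Set.range μ) m) :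
    Filter.Tendsto (gibbsEntropy μ) Filter.atTop
      (nhds (Real.log (Finset.univ.filter (fun j => μ j = m)).card)) := by
  obtain ⟨⟨i, hi⟩, hub⟩ := hm
  have : Nonempty ι := ⟨i⟩
  have hle : ∀ j, μ j ≤ m := fun j => hub ⟨j, rfl⟩
  have hcard : ((Finset.univ.filter (fun j => μ j = m)).card : ℝ) ≠ 0 := by
    exact_mod_cast (Finset.card_pos.2 ⟨i, by simp [hi]⟩).ne'
  have hZ : Filter.Tendsto (fun γ : ℝ => ∑ j, Real.exp (γ * (μ j - m))) Filter.atTop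
      (nhds ((Finset.univ.filter (fun j => μ j = m)).card : ℝ)) := by
    rw [← Finset.sum_boole]
    refine tendsto_finsetSum _ fun j _ => ?_
    split_ifs with h
    · simp [h]
    · exact Real.tendsto_exp_atBot.comp
        (Filter.tendsto_id.atTop_mul_const_of_neg (sub_neg.2 (lt_of_le_of_ne (hle j) h)))
  have hM : Filter.Tendsto (fun γ : ℝ => ∑ j, γ * ((μ j - m) * Real.exp (γ * (μ j - m))))
      Filter.atTop (nhds 0) := by
    rw [← Finset.sum_const_zero (ι := ι) (s := Finset.univ)]
    refine tendsto_finsetSum _ fun j _ => ?_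
    by_cases h : μ j = m
    · simp [h]
    · have hneg : 0 < m - μ j := sub_pos.2 (lt_of_le_of_ne (hle j) h)
      have := ((Real.tendsto_pow_mul_exp_neg_atTop_nhds_zero 1).comp
        (Filter.tendsto_id.atTop_mul_const hneg)).neg
      rw [neg_zero] at this
      refine this.congr fun γ => ?_
      simp only [Function.comp, id, pow_one]
      rw [show -(γ * (m - μ j)) = γ * (μ j - m) by ring]
      ring
  have h := (hZ.log hcard).sub (hM.div hZ hcard)
  rw [zero_div, sub_zero] at h
  refine h.congr fun γ => ?_
  rw [← gibbsEntropy_sub_const μ m, gibbsEntropy]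
  simp only [Pi.div_apply]
  rw [← Finset.mul_sum]
  ring

end GibbsEntropy

/-- existence and uniqueness of the Gibbs parameter `γ > 0`
solving the entropy equation (Theorem 4(ii)). -/
theorem stmt1 (N : ℕ) (hN : 1 ≤ N) (μ : Fin N → ℝ) (hμ : ∀ j, 0 ≤ μ j)
    (hnc : ∃ i j, μ i ≠ μ j)
    (μmax : ℝ) (hmax : IsGreatest (Set.range μ) μmax)
    (d : ℕ) (hd : d = (Finset.univ.filter (fun j => μ j = μmax)).card)
    (s : ℝ) (hs1 : Real.log d < s) (hs2 : s < Real.log N) :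
    ∃! γ : ℝ, 0 < γ ∧
      Real.log (∑ j, Real.exp (γ * μ j)) -
        (γ / (∑ j, Real.exp (γ * μ j))) * (∑ j, μ j * Real.exp (γ * μ j)) = s := by
  change ∃! γ : ℝ, 0 < γ ∧ gibbsEntropy μ γ = s
  have : Nonempty (Fin N) := hnc.nonempty
  have hzero : gibbsEntropy μ 0 = Real.log N := by simp [gibbsEntropy]
  have hlim := tendsto_gibbsEntropy_atTop μ hmax
  rw [← hd] at hlim
  obtain ⟨b, hbs, hb⟩ := ((hlim.eventually_lt_const hs1).and (Filter.eventually_ge_atTop 0)).exists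
  obtain ⟨γ, hγ, hγs⟩ := intermediate_value_Icc' hb
    (fun γ _ => (hasDerivAt_gibbsEntropy μ γ).continuousAt.continuousWithinAt)
    ⟨hbs.le, hzero ▸ hs2.le⟩
  have hγ0 : γ ≠ 0 := by
    rintro rfl
    exact hs2.ne (hγs.symm.trans hzero)
  refine ⟨γ, ⟨lt_of_le_of_ne hγ.1 hγ0.symm, hγs⟩, fun γ' h => ?_⟩
  exact (strictAntiOn_gibbsEntropy μ hnc).injOn h.1.le hγ.1 (h.2.trans hγs.symm)
end

section
/- Let N ≥ 1 and let μ : Fin N → ℝ satisfy μ j ≥ 0 for all j, and assume μ is not constant. Let μmax = max_j μ j, let d be the number of indices j with μ j = μmax, and let s be a real number with log d < s < log N. If γ > 0 satisfies log Z(γ) − (γ / Z(γ)) * Σ_j μ j * exp(γ * μ j) = s, where Z(γ) = Σ_j exp(γ * μ j), then the supremum of Σ_j μ j * λ j over all λ ∈ Δ_N with H(λ) ≥ s equals (1 / Z(γ)) * Σ_j μ j * exp(γ * μ j); it is attained at the Gibbs vector λ j = exp(γ * μ j) / Z(γ), and this value is strictly smaller than μmax. -/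
open scoped Classical

/-- Pointwise form of Gibbs' inequality. -/
theorem Real.negMulLog_le_sub_sub_mul_log {x q : ℝ} (hx : 0 ≤ x) (hq : 0 < q) :
    Real.negMulLog x ≤ q - x - x * Real.log q := by
  rcases hx.eq_or_lt with rfl | hx
  · simpa using hq.le
  have h := mul_le_mul_of_nonneg_left (Real.log_le_sub_one_of_pos (div_pos hq hx)) hx.le
  rw [Real.log_div hq.ne' hx.ne', mul_sub, mul_sub, mul_div_cancel₀ _ hx.ne'] at h
  rw [Real.negMulLog]
  linarith

/-- Gibbs' inequality: the entropy of a probability vector is at most its cross entropy relative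
to another positive probability vector. -/
theorem sum_negMulLog_le_neg_sum_mul_log {ι : Type*} [Fintype ι] {p q : ι → ℝ}
    (hp : ∀ j, 0 ≤ p j) (hq : ∀ j, 0 < q j) (hp1 : ∑ j, p j = 1) (hq1 : ∑ j, q j = 1) :
    ∑ j, Real.negMulLog (p j) ≤ -∑ j, p j * Real.log (q j) := by
  calc ∑ j, Real.negMulLog (p j) ≤ ∑ j, (q j - p j - p j * Real.log (q j)) :=
        Finset.sum_le_sum fun j _ => Real.negMulLog_le_sub_sub_mul_log (hp j) (hq j)
    _ = -∑ j, p j * Real.log (q j) := by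
        simp [Finset.sum_sub_distrib, hp1, hq1]

/-- The cross entropy of a probability vector relative to a Gibbs vector. -/
theorem neg_sum_mul_log_gibbs {ι : Type*} [Fintype ι] (μ : ι → ℝ) (γ : ℝ) {Z : ℝ} (hZ : 0 < Z)
    {p : ι → ℝ} (hp1 : ∑ j, p j = 1) :
    -∑ j, p j * Real.log (Real.exp (γ * μ j) / Z) = Real.log Z - γ * ∑ j, μ j * p j := by
  have h (j) : p j * Real.log (Real.exp (γ * μ j) / Z) =
      γ * (μ j * p j) - p j * Real.log Z := by
    rw [Real.log_div (Real.exp_ne_zero _) hZ.ne', Real.log_exp]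
    ring
  simp_rw [h, Finset.sum_sub_distrib, ← Finset.mul_sum, ← Finset.sum_mul, hp1]
  ring

/-- high-entanglement regime of Theorem 4(ii): for `γ > 0` solving
the entropy equation, the entropy-constrained linear maximization over the
simplex is attained at the Gibbs vector, and its value is strictly smaller
than `μmax`. -/
theorem stmt2 (N : ℕ) (hN : 1 ≤ N) (μ : Fin N → ℝ) (hμ : ∀ j, 0 ≤ μ j)
    (hnc : ∃ i j, μ i ≠ μ j)
    (μmax : ℝ) (hmax : IsGreatest (Set.range μ) μmax)
    (d : ℕ) (hd : d = (Finset.univ.filter (fun j => μ j = μmax)).card)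
    (s : ℝ) (hs1 : Real.log d < s) (hs2 : s < Real.log N)
    (γ : ℝ) (hγ : 0 < γ)
    (hγeq : Real.log (∑ j, Real.exp (γ * μ j)) -
        (γ / (∑ j, Real.exp (γ * μ j))) * (∑ j, μ j * Real.exp (γ * μ j)) = s) :
    (∀ lam : Fin N → ℝ, (∀ j, 0 ≤ lam j) → (∑ j, lam j) = 1 →
        s ≤ ∑ j, Real.negMulLog (lam j) →
        (∑ j, μ j * lam j) ≤
          (1 / (∑ j, Real.exp (γ * μ j))) * (∑ j, μ j * Real.exp (γ * μ j))) ∧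
    (∀ j, 0 ≤ Real.exp (γ * μ j) / (∑ k, Real.exp (γ * μ k))) ∧
    (∑ j, Real.exp (γ * μ j) / (∑ k, Real.exp (γ * μ k))) = 1 ∧
    s ≤ (∑ j, Real.negMulLog (Real.exp (γ * μ j) / (∑ k, Real.exp (γ * μ k)))) ∧
    (∑ j, μ j * (Real.exp (γ * μ j) / (∑ k, Real.exp (γ * μ k)))) =
      (1 / (∑ j, Real.exp (γ * μ j))) * (∑ j, μ j * Real.exp (γ * μ j)) ∧
    (1 / (∑ j, Real.exp (γ * μ j))) * (∑ j, μ j * Real.exp (γ * μ j)) < μmax := by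
  obtain ⟨i₀, k₀, hik⟩ := hnc
  have hle (j) : μ j ≤ μmax := hmax.2 ⟨j, rfl⟩
  have hZ : 0 < ∑ j, Real.exp (γ * μ j) :=
    Finset.sum_pos (fun j _ => Real.exp_pos _) ⟨i₀, Finset.mem_univ _⟩
  set Z := ∑ j, Real.exp (γ * μ j) with hZdef
  have hq (j) : 0 < Real.exp (γ * μ j) / Z := div_pos (Real.exp_pos _) hZ
  have hq1 : ∑ j, Real.exp (γ * μ j) / Z = 1 := by
    rw [← Finset.sum_div, ← hZdef, div_self hZ.ne']
  have hmean : ∑ j, μ j * (Real.exp (γ * μ j) / Z) =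
      (1 / Z) * ∑ j, μ j * Real.exp (γ * μ j) := by
    rw [Finset.mul_sum]
    exact Finset.sum_congr rfl fun j _ => by ring
  have hs : Real.log Z - γ * ((1 / Z) * ∑ j, μ j * Real.exp (γ * μ j)) = s := by
    rw [← hγeq]
    ring
  refine ⟨fun p hp hp1 hps => ?_, fun j => (hq j).le, hq1, ?_, hmean, ?_⟩
  · have h := sum_negMulLog_le_neg_sum_mul_log hp hq hp1 hq1
    rw [neg_sum_mul_log_gibbs μ γ hZ hp1] at h
    refine le_of_mul_le_mul_left ?_ hγ
    linarith
  · have h := neg_sum_mul_log_gibbs μ γ hZ hq1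
    rw [hmean, hs, ← Finset.sum_neg_distrib] at h
    simp only [Real.negMulLog, neg_mul]
    exact h.ge
  · have hlt : ∃ j, μ j < μmax := by
      by_contra! h
      exact hik (((hle i₀).antisymm (h i₀)).trans ((hle k₀).antisymm (h k₀)).symm)
    obtain ⟨j₀, hj₀⟩ := hlt
    rw [one_div_mul_eq_div, div_lt_iff₀ hZ, hZdef, Finset.mul_sum]
    exact Finset.sum_lt_sum (fun j _ => mul_le_mul_of_nonneg_right (hle j) (Real.exp_pos _).le)
      ⟨j₀, Finset.mem_univ _, mul_lt_mul_of_pos_right hj₀ (Real.exp_pos _)⟩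
end

section
/- Let N ≥ 1 and let ν : Fin N → ℝ satisfy ν j ≥ 0 for all j. Let νmin = min_j ν j and let d be the number of indices j with ν j = νmin. If s is a real number with 0 ≤ s ≤ log d, then the infimum of Σ_j ν j * λ j over all λ ∈ Δ_N with H(λ) ≥ s equals νmin, and it is attained by the vector that assigns weight 1/d to each of the d indices attaining νmin and 0 elsewhere. -/
open scoped Classical

/-- low-entanglement regime of the relaxed minimal privacy energy
(Theorem 5(i)): for `0 ≤ s ≤ log d` the entropy-constrained linear minimization
over the simplex equals `νmin`, attained by uniform weights on the minimizing
indices. -/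
theorem stmt5 (N : ℕ) (hN : 1 ≤ N) (ν : Fin N → ℝ) (hν : ∀ j, 0 ≤ ν j)
    (νmin : ℝ) (hmin : IsLeast (Set.range ν) νmin)
    (d : ℕ) (hd : d = (Finset.univ.filter (fun j => ν j = νmin)).card)
    (s : ℝ) (hs0 : 0 ≤ s) (hs1 : s ≤ Real.log d) :
    (∀ lam : Fin N → ℝ, (∀ j, 0 ≤ lam j) → (∑ j, lam j) = 1 →
        s ≤ (∑ j, Real.negMulLog (lam j)) → νmin ≤ ∑ j, ν j * lam j) ∧
    (∀ j, 0 ≤ (if ν j = νmin then (1 : ℝ) / d else 0)) ∧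
    (∑ j, (if ν j = νmin then (1 : ℝ) / d else 0)) = 1 ∧
    s ≤ (∑ j, Real.negMulLog (if ν j = νmin then (1 : ℝ) / d else 0)) ∧
    (∑ j, ν j * (if ν j = νmin then (1 : ℝ) / d else 0)) = νmin := by
  have hcard : ∀ c : ℝ, (∑ j, if ν j = νmin then c else 0) = d * c := fun c => by
    rw [← Finset.sum_filter, Finset.sum_const, nsmul_eq_mul, hd]
  have hd0 : (d : ℝ) ≠ 0 := by
    obtain ⟨j, hj⟩ := hmin.1
    rw [hd, Nat.cast_ne_zero]
    exact Finset.card_ne_zero_of_mem (Finset.mem_filter.2 ⟨Finset.mem_univ j, hj⟩)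
  refine ⟨fun lam hlam hsum _ => ?_, fun j => ?_, ?_, ?_, ?_⟩
  · calc νmin = ∑ j, νmin * lam j := by rw [← Finset.mul_sum, hsum, mul_one]
      _ ≤ ∑ j, ν j * lam j := Finset.sum_le_sum fun j _ =>
        mul_le_mul_of_nonneg_right (hmin.2 ⟨j, rfl⟩) (hlam j)
  · split_ifs <;> positivity
  · rw [hcard, mul_one_div_cancel hd0]
  · simp only [apply_ite Real.negMulLog, Real.negMulLog_zero]
    rw [hcard, Real.negMulLog, one_div, Real.log_inv, neg_mul_neg, mul_inv_cancel_left₀ hd0]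
    exact hs1
  · have h : ∀ j, ν j * (if ν j = νmin then (1 : ℝ) / d else 0) =
        if ν j = νmin then νmin * (1 / d) else 0 := fun j => by
      split_ifs with hj
      · rw [hj]
      · rw [mul_zero]
    rw [Finset.sum_congr rfl fun j _ => h j, hcard, mul_left_comm, mul_one_div_cancel hd0, mul_one]
end

section
/- Let N ≥ 1, let K be an N×N complex positive semidefinite Hermitian matrix with eigenvalues α_1 ≥ ⋯ ≥ α_N ≥ 0 listed in nonincreasing order with multiplicity, and let λ : Fin N → ℝ satisfy λ_1 ≥ λ_2 ≥ ⋯ ≥ λ_N ≥ 0. Let X = Λ^{1/2} · K · Λ^{1/2}, where Λ^{1/2} = diag(√λ_1, …, √λ_N). Then for every m with 1 ≤ m ≤ N, the sum of the m largest eigenvalues of the Hermitian matrix X satisfies Σ_{i=1}^{m} σ_i(X) ≤ Σ_{i=1}^{m} α_i * λ_i. -/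
open Matrix
open scoped ComplexOrder

/-- A nonnegative antitone function on `Fin N` extends to one on `ℕ`. -/
lemma exists_antitone_nat_extension {N : ℕ} {f : Fin N → ℝ} (hf : Antitone f)
    (hf0 : ∀ i, 0 ≤ f i) :
    ∃ a : ℕ → ℝ, Antitone a ∧ (∀ n, 0 ≤ a n) ∧ ∀ i : Fin N, a i = f i := by
  refine ⟨fun n => if h : n < N then f ⟨n, h⟩ else 0, fun x y hxy => ?_, fun n => ?_, fun i => ?_⟩
  · by_cases hy : y < N
    · simpa [hy, hxy.trans_lt hy] using hf (Fin.mk_le_mk.2 hxy)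
    · by_cases hx : x < N <;> simp [hx, hy, hf0]
  · by_cases hn : n < N <;> simp [hn, hf0]
  · simp

/-- Abel's inequality. -/
lemma mul_sum_range_le_sum_range_mul {a c : ℕ → ℝ} (ha : Antitone a)
    (hc : ∀ k, 0 ≤ ∑ i ∈ Finset.range k, c i) (n : ℕ) :
    a n * ∑ i ∈ Finset.range n, c i ≤ ∑ i ∈ Finset.range n, a i * c i := by
  induction n with
  | zero => simp
  | succ n ih =>
    have h := mul_le_mul_of_nonneg_right (ha n.le_succ) (hc (n + 1))
    rw [Finset.sum_range_succ] at h ⊢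
    rw [Finset.sum_range_succ]
    linarith

/-- Weighted sums with nonnegative antitone weights are monotone with respect to weak
majorization of partial sums. -/
lemma sum_mul_le_sum_mul_of_partial_sums_le {N : ℕ} {f d e : Fin N → ℝ} (hf : Antitone f)
    (hf0 : ∀ i, 0 ≤ f i)
    (h : ∀ k : ℕ, ∑ i ∈ Finset.univ.filter (fun i : Fin N => (i : ℕ) < k), d i ≤
      ∑ i ∈ Finset.univ.filter (fun i : Fin N => (i : ℕ) < k), e i) :
    ∑ i, f i * d i ≤ ∑ i, f i * e i := by
  obtain ⟨a, ha, ha0, haf⟩ := exists_antitone_nat_extension hf hf0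
  let c : ℕ → ℝ := fun n => if hn : n < N then e ⟨n, hn⟩ - d ⟨n, hn⟩ else 0
  have hcs (k : ℕ) : ∑ i ∈ Finset.range k, c i =
      ∑ i ∈ Finset.univ.filter (fun i : Fin N => (i : ℕ) < k), (e i - d i) := by
    symm
    refine Finset.sum_bij_ne_zero (fun i _ _ => (i : ℕ)) ?_ ?_ ?_ ?_
    · intro i hi _
      simpa using hi
    · intro i _ _ j _ _ hij
      exact Fin.ext hij
    · intro n hn hne
      by_cases hN : n < N
      · exact ⟨⟨n, hN⟩, by simpa using hn, by simpa [c, hN] using hne, rfl⟩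
      · simp [c, hN] at hne
    · intro i _ _
      simp [c]
  have hc (k : ℕ) : 0 ≤ ∑ i ∈ Finset.range k, c i := by
    rw [hcs, Finset.sum_sub_distrib]
    exact sub_nonneg.2 (h k)
  have key := (mul_nonneg (ha0 N) (hc N)).trans (mul_sum_range_le_sum_range_mul ha hc N)
  rw [Finset.sum_range] at key
  simpa [c, haf, mul_sub, Finset.sum_sub_distrib] using key

/-- A sum with weights in `[0, 1]` of total mass `k` is at most the sum of the `k` largest terms. -/
lemma sum_mul_le_sum_top {N : ℕ} {f q : Fin N → ℝ} (hf : Antitone f) (hf0 : ∀ i, 0 ≤ f i)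
    (k : ℕ) (hq0 : ∀ i, 0 ≤ q i) (hq1 : ∀ i, q i ≤ 1)
    (hq : ∑ i, q i = ∑ _i ∈ Finset.univ.filter (fun i : Fin N => (i : ℕ) < k), (1 : ℝ)) :
    ∑ i, f i * q i ≤ ∑ i ∈ Finset.univ.filter (fun i : Fin N => (i : ℕ) < k), f i := by
  obtain ⟨a, ha, -, haf⟩ := exists_antitone_nat_extension hf hf0
  have hterm (i : Fin N) :
      0 ≤ (f i - a (k - 1)) * ((if (i : ℕ) < k then 1 else 0) - q i) := by
    rw [← haf i]
    split_ifs with hi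
    · exact mul_nonneg (sub_nonneg.2 (ha (by omega))) (sub_nonneg.2 (hq1 i))
    · exact mul_nonneg_of_nonpos_of_nonpos (sub_nonpos.2 (ha (by omega))) (by linarith [hq0 i])
  have hsum := Finset.sum_nonneg fun i (_ : i ∈ Finset.univ) => hterm i
  rw [Finset.sum_filter] at hq ⊢
  simp only [sub_mul, mul_sub, Finset.sum_sub_distrib, ← Finset.mul_sum, ← hq] at hsum
  simpa using hsum

section Unitary

variable {N : ℕ}

lemma sum_normSq_row_of_mem_unitaryGroup {U : Matrix (Fin N) (Fin N) ℂ}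
    (hU : U ∈ unitaryGroup (Fin N) ℂ) (i : Fin N) : ∑ j, Complex.normSq (U i j) = 1 := by
  have h := congrFun (congrFun (mem_unitaryGroup_iff.1 hU) i) i
  simp only [star_eq_conjTranspose, mul_apply, conjTranspose_apply, one_apply_eq,
    Complex.star_def, Complex.mul_conj] at h
  exact_mod_cast h

lemma sum_normSq_col_of_mem_unitaryGroup {U : Matrix (Fin N) (Fin N) ℂ}
    (hU : U ∈ unitaryGroup (Fin N) ℂ) (j : Fin N) : ∑ i, Complex.normSq (U i j) = 1 := by
  simpa using sum_normSq_row_of_mem_unitaryGroup (Unitary.star_mem hU) j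

/-- Ky Fan's bound for a diagonal matrix compressed to `k` orthonormal vectors. -/
lemma sum_diag_conj_le_sum_top {U : Matrix (Fin N) (Fin N) ℂ} (hU : U ∈ unitaryGroup (Fin N) ℂ)
    {f : Fin N → ℝ} (hf : Antitone f) (hf0 : ∀ i, 0 ≤ f i) (k : ℕ) :
    ∑ l ∈ Finset.univ.filter (fun l : Fin N => (l : ℕ) < k), ∑ j, f j * Complex.normSq (U j l) ≤
      ∑ i ∈ Finset.univ.filter (fun i : Fin N => (i : ℕ) < k), f i := by
  rw [Finset.sum_comm]
  simp only [← Finset.mul_sum]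
  refine sum_mul_le_sum_top hf hf0 k
    (fun j => Finset.sum_nonneg fun l _ => Complex.normSq_nonneg _) (fun j => ?_) ?_
  · rw [← sum_normSq_row_of_mem_unitaryGroup hU j]
    exact Finset.sum_le_sum_of_subset_of_nonneg (Finset.subset_univ _)
      fun l _ _ => Complex.normSq_nonneg _
  · rw [Finset.sum_comm]
    exact Finset.sum_congr rfl fun l _ => sum_normSq_col_of_mem_unitaryGroup hU l

/-- The diagonal entries of `Cᴴ * diagonal a * C`. -/
lemma conjTranspose_mul_diagonal_mul_apply_self (C : Matrix (Fin N) (Fin N) ℂ) (a : Fin N → ℝ)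
    (l : Fin N) :
    (Cᴴ * diagonal (fun i => (a i : ℂ)) * C) l l =
      ((∑ i, a i * Complex.normSq (C i l) : ℝ) : ℂ) := by
  simp only [mul_apply (M := _ * _), mul_diagonal, conjTranspose_apply,
    Complex.ofReal_sum, Complex.ofReal_mul, Complex.normSq_eq_conj_mul_self, Complex.star_def]
  exact Finset.sum_congr rfl fun i _ => by ring

lemma sum_normSq_col_unitary_mul_diagonal_mul {U V : Matrix (Fin N) (Fin N) ℂ}
    (hU : U ∈ unitaryGroup (Fin N) ℂ) {f : Fin N → ℝ} (hf0 : ∀ i, 0 ≤ f i) (l : Fin N) :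
    ∑ i, Complex.normSq ((Uᴴ * diagonal (fun i => (Real.sqrt (f i) : ℂ)) * V) i l) =
      ∑ j, f j * Complex.normSq (V j l) := by
  set D := diagonal (fun i => (Real.sqrt (f i) : ℂ)) with hD
  have hDH : Dᴴ = D := by
    rw [hD, diagonal_conjTranspose]
    congr 1
    ext i
    simp
  have hDD : D * D = diagonal (fun i => (f i : ℂ)) := by
    rw [hD, diagonal_mul_diagonal]
    congr 1
    ext i
    exact_mod_cast congrArg (fun x : ℝ => (x : ℂ)) (Real.mul_self_sqrt (hf0 i))
  have hUU : U * Uᴴ = 1 := mem_unitaryGroup_iff.1 hU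
  have h : (Uᴴ * D * V)ᴴ * diagonal (fun _ => ((1 : ℝ) : ℂ)) * (Uᴴ * D * V) =
      Vᴴ * diagonal (fun i => (f i : ℂ)) * V := by
    rw [← hDD, Complex.ofReal_one, diagonal_one, mul_one, conjTranspose_mul, conjTranspose_mul,
      conjTranspose_conjTranspose, hDH]
    calc Vᴴ * (D * U) * (Uᴴ * D * V) = Vᴴ * D * (U * Uᴴ) * D * V := by
          simp only [Matrix.mul_assoc]
      _ = Vᴴ * (D * D) * V := by rw [hUU]; simp only [Matrix.mul_assoc, Matrix.one_mul]
  have hl := congrFun (congrFun h l) l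
  rw [conjTranspose_mul_diagonal_mul_apply_self, conjTranspose_mul_diagonal_mul_apply_self] at hl
  simpa using Complex.ofReal_injective hl

lemma conjTranspose_mul_mul_eq_of_eq_conj {U A B : Matrix (Fin N) (Fin N) ℂ}
    (hU : U ∈ unitaryGroup (Fin N) ℂ) (h : A = U * B * Uᴴ) : Uᴴ * A * U = B := by
  have hUU : Uᴴ * U = 1 := mem_unitaryGroup_iff'.1 hU
  calc Uᴴ * A * U = (Uᴴ * U) * B * (Uᴴ * U) := by rw [h]; simp only [Matrix.mul_assoc]
    _ = B := by rw [hUU, Matrix.one_mul, Matrix.mul_one]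

end Unitary

/-- Ky Fan-type partial-sum bound (Step 2 of the proof of
Theorem 4): for `X = Λ^{1/2} K Λ^{1/2}` the sum of the `m` largest eigenvalues
of `X` is at most `Σ_{i<m} α_i λ_i`, where `α` lists the eigenvalues of `K` in
nonincreasing order and `λ` is nonincreasing and nonnegative.  The hypotheses
`hKα` and `hXσ` say that `α` (resp. `σ`) lists the eigenvalues of `K`
(resp. `X`) in nonincreasing order with multiplicity. -/
theorem stmt9 (N : ℕ) (hN : 1 ≤ N)
    (K : Matrix (Fin N) (Fin N) ℂ) (hK : K.PosSemidef)
    (α : Fin N → ℝ) (hα : Antitone α)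
    (hKα : ∃ W ∈ Matrix.unitaryGroup (Fin N) ℂ,
        K = W * Matrix.diagonal (fun i => (α i : ℂ)) * Wᴴ)
    (lam : Fin N → ℝ) (hlam : Antitone lam) (hlam0 : ∀ j, 0 ≤ lam j)
    (σ : Fin N → ℝ) (hσ : Antitone σ)
    (hXσ : ∃ W ∈ Matrix.unitaryGroup (Fin N) ℂ,
        Matrix.diagonal (fun i => (Real.sqrt (lam i) : ℂ)) * K *
            Matrix.diagonal (fun i => (Real.sqrt (lam i) : ℂ)) =
          W * Matrix.diagonal (fun i => (σ i : ℂ)) * Wᴴ)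
    (m : ℕ) (hm1 : 1 ≤ m) (hm : m ≤ N) :
    (∑ i ∈ Finset.univ.filter (fun i : Fin N => (i : ℕ) < m), σ i) ≤
      ∑ i ∈ Finset.univ.filter (fun i : Fin N => (i : ℕ) < m), α i * lam i := by

  obtain ⟨W, hW, hKW⟩ := hKα
  obtain ⟨V, hV, hXV⟩ := hXσ
  have hα0 (i : Fin N) : 0 ≤ α i := by
    have h := (hK.conjTranspose_mul_mul_same W).diag_nonneg (i := i)
    rw [conjTranspose_mul_mul_eq_of_eq_conj hW hKW, diagonal_apply_eq] at h
    exact_mod_cast h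
  set D := diagonal (fun i => (Real.sqrt (lam i) : ℂ)) with hD
  have hDH : Dᴴ = D := by
    rw [hD, diagonal_conjTranspose]
    congr 1
    ext i
    simp
  let B : Fin N → Fin N → ℝ := fun i l => Complex.normSq ((Wᴴ * D * V) i l)
  have hB0 (i l : Fin N) : 0 ≤ B i l := Complex.normSq_nonneg _
  have hBcol (l : Fin N) : ∑ i, B i l = ∑ j, lam j * Complex.normSq (V j l) :=
    sum_normSq_col_unitary_mul_diagonal_mul hW hlam0 l
  have hBrow (i : Fin N) : ∑ l, B i l = ∑ j, lam j * Complex.normSq (W j i) := by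
    rw [← sum_normSq_col_unitary_mul_diagonal_mul hV hlam0 i]
    refine Finset.sum_congr rfl fun l _ => ?_
    have h : Vᴴ * D * W = (Wᴴ * D * V)ᴴ := by
      simp only [conjTranspose_mul, conjTranspose_conjTranspose, hDH, Matrix.mul_assoc]
    rw [← hD, h, conjTranspose_apply, Complex.star_def, Complex.normSq_conj]
  have hσB (l : Fin N) : σ l = ∑ i, α i * B i l := by
    have h : (Wᴴ * D * V)ᴴ * diagonal (fun i => (α i : ℂ)) * (Wᴴ * D * V) =
        diagonal (fun i => (σ i : ℂ)) := by
      rw [← conjTranspose_mul_mul_eq_of_eq_conj hV hXV, hKW]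
      simp only [conjTranspose_mul, conjTranspose_conjTranspose, hDH, Matrix.mul_assoc]
    have hl := congrFun (congrFun h l) l
    rw [conjTranspose_mul_diagonal_mul_apply_self, diagonal_apply_eq] at hl
    exact (Complex.ofReal_injective hl).symm
  have hpartial (k : ℕ) : ∑ i ∈ Finset.univ.filter (fun i : Fin N => (i : ℕ) < k),
        ∑ l ∈ Finset.univ.filter (fun l : Fin N => (l : ℕ) < m), B i l ≤
      ∑ i ∈ Finset.univ.filter (fun i : Fin N => (i : ℕ) < k), if (i : ℕ) < m then lam i else 0 := by
    rw [← Finset.sum_filter, Finset.filter_filter]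
    rcases le_total k m with hkm | hmk
    · calc _ ≤ ∑ i ∈ Finset.univ.filter (fun i : Fin N => (i : ℕ) < k), ∑ l, B i l :=
            Finset.sum_le_sum fun i _ => Finset.sum_le_sum_of_subset_of_nonneg
              (Finset.subset_univ _) fun l _ _ => hB0 i l
        _ ≤ ∑ i ∈ Finset.univ.filter (fun i : Fin N => (i : ℕ) < k), lam i := by
            simp only [hBrow]
            exact sum_diag_conj_le_sum_top hW hlam hlam0 k
        _ = _ := by
            congr 1
            ext i
            simp only [Finset.mem_filter, Finset.mem_univ, true_and]
            omega
    · rw [Finset.sum_comm]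
      calc _ ≤ ∑ l ∈ Finset.univ.filter (fun l : Fin N => (l : ℕ) < m), ∑ i, B i l :=
            Finset.sum_le_sum fun l _ => Finset.sum_le_sum_of_subset_of_nonneg
              (Finset.subset_univ _) fun i _ _ => hB0 i l
        _ ≤ ∑ i ∈ Finset.univ.filter (fun i : Fin N => (i : ℕ) < m), lam i := by
            simp only [hBcol]
            exact sum_diag_conj_le_sum_top hV hlam hlam0 m
        _ = _ := by
            congr 1
            ext i
            simp only [Finset.mem_filter, Finset.mem_univ, true_and]
            omega
  calc _ = ∑ i, α i * ∑ l ∈ Finset.univ.filter (fun l : Fin N => (l : ℕ) < m), B i l := by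
        simp only [hσB, Finset.mul_sum]
        exact Finset.sum_comm
    _ ≤ ∑ i, α i * (if (i : ℕ) < m then lam i else 0) :=
        sum_mul_le_sum_mul_of_partial_sums_le hα hα0 hpartial
    _ = _ := by simp only [mul_ite, mul_zero, Finset.sum_filter]
end

section
/- Let N ≥ 1, let λ : Fin N → ℝ satisfy λ_1 ≥ ⋯ ≥ λ_N ≥ 0, and let Λ^{1/2} = diag(√λ_1,…,√λ_N). Let K_a and K_b be N×N complex positive semidefinite Hermitian matrices with eigenvalues α_1 ≥ ⋯ ≥ α_N and β_1 ≥ ⋯ ≥ β_N listed in nonincreasing order with multiplicity. Then the supremum over all pairs of unitary N×N matrices (U, V) of Re Tr(Λ^{1/2} · (U K_a U†) · Λ^{1/2} · (V K_b V†)) equals Σ_{j=1}^{N} α_j * β_j * λ_j, and the supremum is attained. -/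
open Matrix
open scoped ComplexOrder

/-- Abel summation: a sum weighted by a nonnegative antitone sequence is nonnegative as soon as
all partial sums are. -/
theorem sum_mul_nonneg_of_antitone {n : ℕ} (a c : Fin n → ℝ) (ha : Antitone a)
    (ha0 : ∀ i, 0 ≤ a i) (hc : ∀ k, 0 ≤ ∑ i, if i ≤ k then c i else 0) :
    0 ≤ ∑ i, a i * c i := by
  induction n with
  | zero => simp
  | succ n ih =>
    have hrec := ih (fun i => a i.castSucc - a (Fin.last n)) (fun i => c i.castSucc)
      (fun i j hij => sub_le_sub_right (ha (Fin.castSucc_le_castSucc_iff.2 hij)) _)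
      (fun i => sub_nonneg.2 (ha (Fin.le_last _)))
      (fun k => by
        have h := hc k.castSucc
        rw [Fin.sum_univ_castSucc, if_neg (not_le.2 (Fin.castSucc_lt_last k))] at h
        simpa only [Fin.castSucc_le_castSucc_iff, add_zero] using h)
    have hlast := hc (Fin.last n)
    simp only [Fin.le_last, if_true] at hlast
    have hmul := mul_nonneg (ha0 (Fin.last n)) hlast
    rw [Fin.sum_univ_castSucc] at hmul ⊢
    simp only [sub_mul, Finset.sum_sub_distrib, ← Finset.mul_sum] at hrec
    linarith

/-- A nonnegative array whose row and column sums have partial sums dominated by those of `l`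
satisfies the corresponding bilinear bound for nonnegative antitone weights. -/
theorem sum_sum_mul_le_of_partial_sums_le {n : ℕ} (G : Fin n → Fin n → ℝ) (l a b : Fin n → ℝ)
    (hG : ∀ i j, 0 ≤ G i j) (ha : Antitone a) (ha0 : ∀ i, 0 ≤ a i)
    (hb : Antitone b) (hb0 : ∀ i, 0 ≤ b i)
    (hrow : ∀ k, (∑ i, if i ≤ k then ∑ j, G i j else 0) ≤ ∑ i, if i ≤ k then l i else 0)
    (hcol : ∀ k, (∑ j, if j ≤ k then ∑ i, G i j else 0) ≤ ∑ j, if j ≤ k then l j else 0) :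
    ∑ i, ∑ j, a i * b j * G i j ≤ ∑ j, a j * b j * l j := by
  have main : 0 ≤ ∑ i, a i * (b i * l i - ∑ j, b j * G i j) := by
    refine sum_mul_nonneg_of_antitone a _ ha ha0 fun k => ?_
    have inner : 0 ≤ ∑ j, b j * ((if j ≤ k then l j else 0) - ∑ i, if i ≤ k then G i j else 0) := by
      refine sum_mul_nonneg_of_antitone b _ hb hb0 fun m => ?_
      have split : (∑ j, if j ≤ m then
            (if j ≤ k then l j else 0) - ∑ i, if i ≤ k then G i j else 0 else 0) =
          (∑ j, if j ≤ min k m then l j else 0) -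
            ∑ j, if j ≤ m then ∑ i, if i ≤ k then G i j else 0 else 0 := by
        rw [← Finset.sum_sub_distrib]
        refine Finset.sum_congr rfl fun j _ => ?_
        by_cases h1 : j ≤ m <;> by_cases h2 : j ≤ k <;> simp [h1, h2]
      rw [split, sub_nonneg]
      rcases le_total k m with h | h
      · rw [min_eq_left h]
        refine le_trans ?_ (hrow k)
        calc (∑ j, if j ≤ m then ∑ i, if i ≤ k then G i j else 0 else 0)
            ≤ ∑ j, ∑ i, if i ≤ k then G i j else 0 := by
              refine Finset.sum_le_sum fun j _ => ?_
              split_ifs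
              · exact le_rfl
              · exact Finset.sum_nonneg fun i _ => by split_ifs <;> simp [hG]
          _ = ∑ i, if i ≤ k then ∑ j, G i j else 0 := by
              rw [Finset.sum_comm]
              refine Finset.sum_congr rfl fun i _ => ?_
              split_ifs <;> simp
      · rw [min_eq_right h]
        refine le_trans (Finset.sum_le_sum fun j _ => ?_) (hcol m)
        split_ifs
        · exact Finset.sum_le_sum fun i _ => by split_ifs <;> simp [hG]
        · exact le_rfl
    convert inner using 1
    simp only [mul_sub, Finset.sum_sub_distrib, Finset.mul_sum, mul_ite, mul_zero]
    rw [Finset.sum_comm (f := fun j i => if i ≤ k then b j * G i j else 0),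
      ← Finset.sum_sub_distrib]
    refine Finset.sum_congr rfl fun i _ => ?_
    split_ifs <;> simp
  simp only [mul_sub, Finset.sum_sub_distrib, Finset.mul_sum, ← mul_assoc] at main
  linarith

/-- Schur's majorization for a doubly stochastic array. -/
theorem partial_sums_le_of_doubly_stochastic {n : ℕ} (G : Fin n → Fin n → ℝ) (l : Fin n → ℝ)
    (hG : ∀ i j, 0 ≤ G i j) (hrow : ∀ i, ∑ j, G i j = 1) (hcol : ∀ j, ∑ i, G i j = 1)
    (hl : Antitone l) (hl0 : ∀ i, 0 ≤ l i) (k : Fin n) :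
    (∑ i, if i ≤ k then ∑ j, G i j * l j else 0) ≤ ∑ i, if i ≤ k then l i else 0 := by
  have h := sum_sum_mul_le_of_partial_sums_le G (fun _ => 1) (fun i => if i ≤ k then 1 else 0) l hG
    (fun i j hij => by
      by_cases hj : j ≤ k
      · simp [hj, hij.trans hj]
      · simp only [hj, if_false]
        split_ifs <;> norm_num)
    (fun i => by split_ifs <;> norm_num) hl hl0
    (fun k => by simp [hrow]) (fun k => by simp [hcol])
  convert h using 1
  · refine Finset.sum_congr rfl fun i _ => ?_
    split_ifs <;> simp [mul_comm]
  · simp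

theorem mul_diagonal_mul_conjTranspose_apply_self {m n : Type*} [Fintype n] [DecidableEq n]
    (M : Matrix m n ℂ) (d : n → ℝ) (i : m) :
    (M * Matrix.diagonal (fun p => (d p : ℂ)) * Mᴴ) i i =
      ((∑ p, Complex.normSq (M i p) * d p : ℝ) : ℂ) := by
  rw [Matrix.mul_apply]
  push_cast
  refine Finset.sum_congr rfl fun p _ => ?_
  rw [Matrix.mul_diagonal, Matrix.conjTranspose_apply, Complex.normSq_eq_conj_mul_self,
    starRingEnd_apply]
  ring

theorem sum_normSq_apply_eq_one {n : Type*} [Fintype n] [DecidableEq n] {M : Matrix n n ℂ}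
    (hM : M * Mᴴ = 1) (i : n) : ∑ p, Complex.normSq (M i p) = 1 := by
  have h := mul_diagonal_mul_conjTranspose_apply_self M (fun _ => 1) i
  simp only [Complex.ofReal_one, Matrix.diagonal_one, mul_one, hM, Matrix.one_apply_eq] at h
  exact_mod_cast h.symm

/-- The squared row norms of `Pᴴ Λ^{1/2} Q` with `P`, `Q` unitary are majorized by `Λ`. -/
theorem partial_sums_normSq_le {n : ℕ} {P Q : Matrix (Fin n) (Fin n) ℂ} (hP : Pᴴ * P = 1)
    (hQ : Q * Qᴴ = 1) (l : Fin n → ℝ) (hl : Antitone l) (hl0 : ∀ i, 0 ≤ l i) (k : Fin n) :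
    (∑ i, if i ≤ k then ∑ j, Complex.normSq
        ((Pᴴ * Matrix.diagonal (fun i => (Real.sqrt (l i) : ℂ)) * Q) i j) else 0) ≤
      ∑ i, if i ≤ k then l i else 0 := by
  set L := Matrix.diagonal (fun i => (Real.sqrt (l i) : ℂ)) with hL
  have hLH : Lᴴ = L := by
    rw [hL, Matrix.diagonal_conjTranspose]
    congr 1
    ext i
    simp
  have hLL : L * L = Matrix.diagonal (fun i => (l i : ℂ)) := by
    rw [hL, Matrix.diagonal_mul_diagonal]
    congr 1
    ext i
    rw [← Complex.ofReal_mul, Real.mul_self_sqrt (hl0 i)]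
  have hrow (i : Fin n) : ∑ j, Complex.normSq ((Pᴴ * L * Q) i j) =
      ∑ p, Complex.normSq (Pᴴ i p) * l p := by
    have h1 := mul_diagonal_mul_conjTranspose_apply_self (Pᴴ * L * Q) (fun _ => 1) i
    have h2 := mul_diagonal_mul_conjTranspose_apply_self Pᴴ l i
    have h3 : Pᴴ * L * Q * (Pᴴ * L * Q)ᴴ = Pᴴ * Matrix.diagonal (fun i => (l i : ℂ)) * Pᴴᴴ := by
      rw [Matrix.conjTranspose_mul, Matrix.conjTranspose_mul, hLH, ← hLL]
      calc Pᴴ * L * Q * (Qᴴ * (L * Pᴴᴴ)) = Pᴴ * L * (Q * Qᴴ) * (L * Pᴴᴴ) := by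
            simp only [Matrix.mul_assoc]
        _ = Pᴴ * (L * L) * Pᴴᴴ := by rw [hQ]; simp only [Matrix.mul_assoc, Matrix.one_mul]
    simp only [Complex.ofReal_one, Matrix.diagonal_one, mul_one] at h1
    rw [h3, h2] at h1
    exact_mod_cast h1.symm
  simp only [hrow]
  refine partial_sums_le_of_doubly_stochastic (fun i p => Complex.normSq (Pᴴ i p)) l
    (fun _ _ => Complex.normSq_nonneg _) ?_ ?_ hl hl0 k
  · exact sum_normSq_apply_eq_one (by rwa [Matrix.conjTranspose_conjTranspose])
  · intro j
    simpa [Matrix.conjTranspose_apply] using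
      sum_normSq_apply_eq_one (M := P) (mul_eq_one_comm.1 hP) j

theorem trace_diagonal_mul_diagonal_mul_conjTranspose {n : Type*} [Fintype n] [DecidableEq n]
    (M : Matrix n n ℂ) (a b : n → ℝ) :
    Matrix.trace (Matrix.diagonal (fun i => (a i : ℂ)) *
        (M * Matrix.diagonal (fun i => (b i : ℂ)) * Mᴴ)) =
      ((∑ i, ∑ j, a i * b j * Complex.normSq (M i j) : ℝ) : ℂ) := by
  rw [Matrix.trace]
  simp only [Matrix.diag_apply, Matrix.diagonal_mul, mul_diagonal_mul_conjTranspose_apply_self]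
  push_cast
  simp only [Finset.mul_sum]
  refine Finset.sum_congr rfl fun i _ => Finset.sum_congr rfl fun j _ => ?_
  ring

theorem re_trace_le_sum_of_unitary {n : ℕ} {P Q : Matrix (Fin n) (Fin n) ℂ}
    (hP : Pᴴ * P = 1) (hQ : Qᴴ * Q = 1) (l a b : Fin n → ℝ) (hl : Antitone l)
    (hl0 : ∀ i, 0 ≤ l i) (ha : Antitone a) (ha0 : ∀ i, 0 ≤ a i) (hb : Antitone b)
    (hb0 : ∀ i, 0 ≤ b i) :
    (Matrix.trace (Matrix.diagonal (fun i => (Real.sqrt (l i) : ℂ)) *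
        (P * Matrix.diagonal (fun i => (a i : ℂ)) * Pᴴ) *
        Matrix.diagonal (fun i => (Real.sqrt (l i) : ℂ)) *
        (Q * Matrix.diagonal (fun i => (b i : ℂ)) * Qᴴ))).re ≤ ∑ j, a j * b j * l j := by
  have hrow := partial_sums_normSq_le hP (mul_eq_one_comm.1 hQ) l hl hl0
  have hcol := partial_sums_normSq_le hQ (mul_eq_one_comm.1 hP) l hl hl0
  set L := Matrix.diagonal (fun i => (Real.sqrt (l i) : ℂ)) with hL
  set A := Matrix.diagonal (fun i => (a i : ℂ)) with hA
  set B := Matrix.diagonal (fun i => (b i : ℂ)) with hB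
  have hLH : Lᴴ = L := by
    rw [hL, Matrix.diagonal_conjTranspose]
    congr 1
    ext i
    simp
  have hMH : (Pᴴ * L * Q)ᴴ = Qᴴ * L * P := by
    simp [Matrix.conjTranspose_mul, hLH, Matrix.mul_assoc]
  have htr : Matrix.trace (L * (P * A * Pᴴ) * L * (Q * B * Qᴴ)) =
      Matrix.trace (A * ((Pᴴ * L * Q) * B * (Pᴴ * L * Q)ᴴ)) := by
    rw [hMH]
    calc Matrix.trace (L * (P * A * Pᴴ) * L * (Q * B * Qᴴ)) =
          Matrix.trace ((L * P) * (A * Pᴴ * L * Q * B * Qᴴ)) := by simp only [Matrix.mul_assoc]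
      _ = Matrix.trace ((A * Pᴴ * L * Q * B * Qᴴ) * (L * P)) := Matrix.trace_mul_comm _ _
      _ = _ := by simp only [Matrix.mul_assoc]
  rw [htr, trace_diagonal_mul_diagonal_mul_conjTranspose, Complex.ofReal_re]
  refine sum_sum_mul_le_of_partial_sums_le _ l a b (fun _ _ => Complex.normSq_nonneg _)
    ha ha0 hb hb0 hrow ?_
  have hswap (i j : Fin n) : Complex.normSq ((Qᴴ * L * P) j i) =
      Complex.normSq ((Pᴴ * L * Q) i j) := by
    rw [← hMH, Matrix.conjTranspose_apply, ← starRingEnd_apply, Complex.normSq_conj]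
  simpa only [hswap] using hcol

theorem nonneg_of_posSemidef_unitary_conj {n : Type*} [Fintype n] [DecidableEq n]
    {K W : Matrix n n ℂ} {a : n → ℝ} (hK : K.PosSemidef) (hW : Wᴴ * W = 1)
    (h : K = W * Matrix.diagonal (fun i => (a i : ℂ)) * Wᴴ) (i : n) : 0 ≤ a i := by
  have hd : Wᴴ * K * W = Matrix.diagonal (fun i => (a i : ℂ)) := by
    calc Wᴴ * K * W = (Wᴴ * W) * Matrix.diagonal (fun i => (a i : ℂ)) * (Wᴴ * W) := by
          rw [h]; simp only [Matrix.mul_assoc]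
      _ = _ := by rw [hW, Matrix.one_mul, Matrix.mul_one]
  have hp := hK.conjTranspose_mul_mul_same W
  rw [hd, Matrix.posSemidef_diagonal_iff] at hp
  exact_mod_cast hp i

/-- the alignment identity (Steps 1–2 of the proof of
Theorem 4): for a fixed nonincreasing Schmidt vector `λ`, the supremum over
pairs of unitaries `(U, V)` of
`Re Tr(Λ^{1/2} (U K_a U†) Λ^{1/2} (V K_b V†))` equals `Σ_j α_j β_j λ_j`, and
it is attained.  The hypotheses `hKaα`, `hKbβ` say that `α` (resp. `β`) lists
the eigenvalues of `K_a` (resp. `K_b`) in nonincreasing order with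
multiplicity. -/
theorem stmt10 (N : ℕ) (hN : 1 ≤ N)
    (lam : Fin N → ℝ) (hlam : Antitone lam) (hlam0 : ∀ j, 0 ≤ lam j)
    (Ka Kb : Matrix (Fin N) (Fin N) ℂ) (hKa : Ka.PosSemidef) (hKb : Kb.PosSemidef)
    (α β : Fin N → ℝ) (hα : Antitone α) (hβ : Antitone β)
    (hKaα : ∃ W ∈ Matrix.unitaryGroup (Fin N) ℂ,
        Ka = W * Matrix.diagonal (fun i => (α i : ℂ)) * Wᴴ)
    (hKbβ : ∃ W ∈ Matrix.unitaryGroup (Fin N) ℂ,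
        Kb = W * Matrix.diagonal (fun i => (β i : ℂ)) * Wᴴ) :
    IsGreatest {x : ℝ | ∃ U ∈ Matrix.unitaryGroup (Fin N) ℂ,
        ∃ V ∈ Matrix.unitaryGroup (Fin N) ℂ,
        x = (Matrix.trace (Matrix.diagonal (fun i => (Real.sqrt (lam i) : ℂ)) *
              (U * Ka * Uᴴ) *
              Matrix.diagonal (fun i => (Real.sqrt (lam i) : ℂ)) *
              (V * Kb * Vᴴ))).re}
      (∑ j : Fin N, α j * β j * lam j) := by
  obtain ⟨Wa, hWa, hKa'⟩ := hKaα
  obtain ⟨Wb, hWb, hKb'⟩ := hKbβ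
  have hWa1 : Waᴴ * Wa = 1 := Matrix.mem_unitaryGroup_iff'.1 hWa
  have hWb1 : Wbᴴ * Wb = 1 := Matrix.mem_unitaryGroup_iff'.1 hWb
  have hα0 := nonneg_of_posSemidef_unitary_conj hKa hWa1 hKa'
  have hβ0 := nonneg_of_posSemidef_unitary_conj hKb hWb1 hKb'
  have key (U W D : Matrix (Fin N) (Fin N) ℂ) :
      U * (W * D * Wᴴ) * Uᴴ = (U * W) * D * (U * W)ᴴ := by
    simp only [Matrix.conjTranspose_mul, Matrix.mul_assoc]
  constructor
  · refine ⟨Waᴴ, Unitary.star_mem hWa, Wbᴴ, Unitary.star_mem hWb, ?_⟩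
    rw [hKa', hKb', key, key, hWa1, hWb1]
    simp only [Matrix.conjTranspose_one, Matrix.one_mul, Matrix.mul_one,
      Matrix.diagonal_mul_diagonal, Matrix.trace_diagonal, ← Complex.ofReal_mul,
      ← Complex.ofReal_sum, Complex.ofReal_re]
    refine Finset.sum_congr rfl fun j _ => ?_
    linear_combination (-(α j * β j)) * Real.mul_self_sqrt (hlam0 j)
  · rintro x ⟨U, hU, V, hV, rfl⟩
    rw [hKa', hKb', key, key]
    exact re_trace_le_sum_of_unitary (Matrix.mem_unitaryGroup_iff'.1 (mul_mem hU hWa))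
      (Matrix.mem_unitaryGroup_iff'.1 (mul_mem hV hWb)) lam α β hlam hlam0 hα hα0 hβ hβ0
end

section
/- Let N ≥ 1, let λ : Fin N → ℝ satisfy λ_1 ≥ ⋯ ≥ λ_N ≥ 0, and let Λ^{1/2} = diag(√λ_1,…,√λ_N). Let K_a and K_b be N×N complex positive semidefinite Hermitian matrices; let α_N denote the smallest eigenvalue of K_a and let β_1 ≥ ⋯ ≥ β_N denote the eigenvalues of K_b in nonincreasing order with multiplicity. Then for all unitary N×N matrices U and V, Re Tr(Λ^{1/2} · (U K_a U†) · Λ^{1/2} · (V K_b V†)) ≥ α_N * Σ_{i=1}^{N} λ_i * β_{N+1−i}. -/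
open Matrix
open scoped ComplexOrder

/-- A bilinear form given by a doubly stochastic matrix is at least the oppositely ordered sum. -/
theorem Antivary.sum_mul_le_sum_sum_of_mem_doublyStochastic {n : Type*} [Fintype n]
    [DecidableEq n] {a b : n → ℝ} (hab : Antivary a b) {S : Matrix n n ℝ}
    (hS : S ∈ doublyStochastic ℝ n) :
    ∑ i, a i * b i ≤ ∑ i, ∑ j, a i * S i j * b j := by
  obtain ⟨w, hw0, hw1, rfl⟩ := exists_eq_sum_perm_of_mem_doublyStochastic hS
  have key : ∑ i, ∑ j, a i * (∑ σ, w σ • Equiv.Perm.permMatrix ℝ σ) i j * b j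
      = ∑ σ, w σ * ∑ i, a i * b (σ i) := by
    simp only [Matrix.sum_apply, Matrix.smul_apply, Finset.mul_sum, Finset.sum_mul]
    simp_rw [Finset.sum_comm (s := Finset.univ (α := n)) (t := Finset.univ (α := Equiv.Perm n))]
    refine Finset.sum_congr rfl fun σ _ => Finset.sum_congr rfl fun i _ => ?_
    rw [Finset.sum_eq_single (σ i)]
    · simp [Equiv.toPEquiv_apply]
      ring
    · intro j _ hj
      simp [Equiv.toPEquiv_apply, hj.symm]
    · simp
  rw [key]
  calc ∑ i, a i * b i = ∑ σ, w σ * ∑ i, a i * b i := by rw [← Finset.sum_mul, hw1, one_mul]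
    _ ≤ _ := Finset.sum_le_sum fun σ _ =>
      mul_le_mul_of_nonneg_left hab.sum_mul_le_sum_mul_comp_perm (hw0 σ)

/-- The entrywise squared modulus of a unitary matrix is doubly stochastic. -/
theorem Matrix.normSq_mem_doublyStochastic {n : Type*} [Fintype n] [DecidableEq n]
    {Q : Matrix n n ℂ} (hQ : Q ∈ Matrix.unitaryGroup n ℂ) :
    Matrix.of (fun i j => Complex.normSq (Q i j)) ∈ doublyStochastic ℝ n := by
  rw [mem_doublyStochastic_iff_sum]
  refine ⟨fun i j => Complex.normSq_nonneg _, fun i => ?_, fun j => ?_⟩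
  · have h := congrFun (congrFun (Matrix.mem_unitaryGroup_iff.1 hQ) i) i
    rw [Matrix.mul_apply] at h
    apply Complex.ofReal_injective
    simpa [Matrix.star_apply, Complex.mul_conj] using h
  · have h := congrFun (congrFun (Matrix.mem_unitaryGroup_iff'.1 hQ) j) j
    rw [Matrix.mul_apply] at h
    apply Complex.ofReal_injective
    simpa [Matrix.star_apply, Complex.normSq_eq_conj_mul_self] using h

theorem Matrix.trace_diagonal_mul_conj_diagonal {n : Type*} [Fintype n] [DecidableEq n]
    (a b : n → ℝ) (Q : Matrix n n ℂ) :
    (Matrix.trace (Matrix.diagonal (fun i => (a i : ℂ)) *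
      (Q * Matrix.diagonal (fun i => (b i : ℂ)) * Qᴴ))).re =
      ∑ i, ∑ j, a i * Complex.normSq (Q i j) * b j := by
  simp only [Matrix.trace, Matrix.diag_apply, Matrix.diagonal_mul]
  simp only [Matrix.mul_apply (M := Q * _), Matrix.mul_diagonal, Matrix.conjTranspose_apply,
    Complex.re_sum, Finset.mul_sum]
  refine Finset.sum_congr rfl fun i _ => Finset.sum_congr rfl fun j _ => ?_
  have : (a i : ℂ) * (Q i j * (b j : ℂ) * star (Q i j))
      = ((a i * Complex.normSq (Q i j) * b j : ℝ) : ℂ) := by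
    push_cast
    rw [← Complex.mul_conj]
    simp only [Complex.star_def]
    ring
  rw [this, Complex.ofReal_re]

open scoped MatrixOrder in
/-- The trace of a product of two positive semidefinite matrices is nonnegative. -/
theorem Matrix.PosSemidef.trace_mul_nonneg {n : Type*} [Fintype n] [DecidableEq n]
    {A B : Matrix n n ℂ} (hA : A.PosSemidef) (hB : B.PosSemidef) : 0 ≤ (A * B).trace := by
  obtain ⟨C, rfl⟩ := CStarAlgebra.nonneg_iff_eq_star_mul_self.1 hB.nonneg
  rw [← Matrix.mul_assoc, Matrix.trace_mul_comm, ← Matrix.mul_assoc]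
  exact (hA.mul_mul_conjTranspose_same C).trace_nonneg

/-- Real numbers on the diagonal of a unitary diagonalization of a positive semidefinite matrix
are nonnegative. -/
theorem Matrix.PosSemidef.nonneg_of_eq_conj_diagonal {n : Type*} [Fintype n] [DecidableEq n]
    {A W : Matrix n n ℂ} (hA : A.PosSemidef) (hW : W ∈ Matrix.unitaryGroup n ℂ) {a : n → ℝ}
    (h : A = W * Matrix.diagonal (fun i => (a i : ℂ)) * Wᴴ) (i : n) : 0 ≤ a i := by
  have hD := hA.conjTranspose_mul_mul_same W
  have hWW : Wᴴ * W = 1 := Matrix.mem_unitaryGroup_iff'.1 hW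
  have hE : Wᴴ * A * W = Matrix.diagonal (fun i => (a i : ℂ)) := by
    rw [h]
    calc _ = (Wᴴ * W) * Matrix.diagonal (fun i => (a i : ℂ)) * (Wᴴ * W) := by
          simp only [Matrix.mul_assoc]
      _ = _ := by rw [hWW, Matrix.one_mul, Matrix.mul_one]
  rw [hE, Matrix.posSemidef_diagonal_iff] at hD
  exact_mod_cast hD i

/-- A lower bound for the eigenvalues of a matrix bounds the matrix from below. -/
theorem Matrix.posSemidef_conj_diagonal_sub_smul_one {n : Type*} [Fintype n] [DecidableEq n]
    {P : Matrix n n ℂ} (hP : P ∈ Matrix.unitaryGroup n ℂ) {a : n → ℝ} {c : ℝ}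
    (hc : ∀ i, c ≤ a i) :
    (P * Matrix.diagonal (fun i => (a i : ℂ)) * Pᴴ - (c : ℂ) • (1 : Matrix n n ℂ)).PosSemidef := by
  have hPP : P * Pᴴ = 1 := Matrix.mem_unitaryGroup_iff.1 hP
  have hD : (Matrix.diagonal fun i => ((a i - c : ℝ) : ℂ)).PosSemidef :=
    Matrix.PosSemidef.diagonal fun i => by
      simpa using Complex.zero_le_real.2 (sub_nonneg.2 (hc i))
  convert hD.mul_mul_conjTranspose_same P using 1
  have : (Matrix.diagonal fun i => ((a i - c : ℝ) : ℂ))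
      = Matrix.diagonal (fun i => (a i : ℂ)) - (c : ℂ) • (1 : Matrix n n ℂ) := by
    ext i j
    by_cases hij : i = j
    · subst hij
      simp
    · simp [hij]
  rw [this, Matrix.mul_sub, Matrix.sub_mul, Matrix.mul_smul, Matrix.smul_mul, Matrix.mul_one, hPP]

/-- lower bound of the proof of Theorem 5 (Case 1): for all
unitaries `U, V`,
`Re Tr(Λ^{1/2} (U K_a U†) Λ^{1/2} (V K_b V†)) ≥ α_N Σ_i λ_i β_{N+1-i}`,
where `α_N = α ⟨N-1,_⟩` is the smallest eigenvalue of `K_a` and `β` lists the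
eigenvalues of `K_b` in nonincreasing order with multiplicity. -/
theorem stmt11 (N : ℕ) (hN : 1 ≤ N)
    (lam : Fin N → ℝ) (hlam : Antitone lam) (hlam0 : ∀ j, 0 ≤ lam j)
    (Ka Kb : Matrix (Fin N) (Fin N) ℂ) (hKa : Ka.PosSemidef) (hKb : Kb.PosSemidef)
    (α β : Fin N → ℝ) (hα : Antitone α) (hβ : Antitone β)
    (hKaα : ∃ W ∈ Matrix.unitaryGroup (Fin N) ℂ,
        Ka = W * Matrix.diagonal (fun i => (α i : ℂ)) * Wᴴ)
    (hKbβ : ∃ W ∈ Matrix.unitaryGroup (Fin N) ℂ,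
        Kb = W * Matrix.diagonal (fun i => (β i : ℂ)) * Wᴴ) :
    ∀ U ∈ Matrix.unitaryGroup (Fin N) ℂ, ∀ V ∈ Matrix.unitaryGroup (Fin N) ℂ,
      α ⟨N - 1, by omega⟩ * (∑ i : Fin N, lam i * β i.rev) ≤
        (Matrix.trace (Matrix.diagonal (fun i => (Real.sqrt (lam i) : ℂ)) *
            (U * Ka * Uᴴ) *
            Matrix.diagonal (fun i => (Real.sqrt (lam i) : ℂ)) *
            (V * Kb * Vᴴ))).re := by
  intro U hU V hV
  obtain ⟨W, hW, hKaW⟩ := hKaα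
  obtain ⟨W', hW', hKbW⟩ := hKbβ
  set c := α ⟨N - 1, by omega⟩ with hc
  have hc0 : 0 ≤ c := hKa.nonneg_of_eq_conj_diagonal hW hKaW _
  have hcα : ∀ i, c ≤ α i := fun i => hα (Fin.le_def.2 (by have := i.2; simp only; omega))
  set D : Matrix (Fin N) (Fin N) ℂ := Matrix.diagonal (fun i => (Real.sqrt (lam i) : ℂ)) with hD
  have hDD : D * D = Matrix.diagonal (fun i => (lam i : ℂ)) := by
    rw [hD, Matrix.diagonal_mul_diagonal]
    congr 1
    funext i
    rw [← Complex.ofReal_mul, Real.mul_self_sqrt (hlam0 i)]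
  have hDH : Dᴴ = D := by
    rw [hD, Matrix.diagonal_conjTranspose]
    congr 1
    funext i
    simp
  have hA : (U * Ka * Uᴴ - (c : ℂ) • (1 : Matrix (Fin N) (Fin N) ℂ)).PosSemidef := by
    have := Matrix.posSemidef_conj_diagonal_sub_smul_one (mul_mem hU hW) hcα
    rw [hKaW]
    simpa only [Matrix.conjTranspose_mul, Matrix.mul_assoc] using this
  have hDAD : (D * (U * Ka * Uᴴ - (c : ℂ) • (1 : Matrix (Fin N) (Fin N) ℂ)) * D).PosSemidef := by
    simpa only [hDH] using hA.mul_mul_conjTranspose_same D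
  have hnonneg := (Complex.le_def.1
    (hDAD.trace_mul_nonneg (hKb.mul_mul_conjTranspose_same V))).1
  have hsplit : D * (U * Ka * Uᴴ - (c : ℂ) • (1 : Matrix (Fin N) (Fin N) ℂ)) * D * (V * Kb * Vᴴ)
      = D * (U * Ka * Uᴴ) * D * (V * Kb * Vᴴ)
        - (c : ℂ) • (Matrix.diagonal (fun i => (lam i : ℂ)) * (V * Kb * Vᴴ)) := by
    rw [Matrix.mul_sub, Matrix.sub_mul, Matrix.sub_mul, Matrix.mul_smul, Matrix.mul_one,
      Matrix.smul_mul, Matrix.smul_mul, hDD]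
  rw [hsplit, Matrix.trace_sub, Matrix.trace_smul, Complex.sub_re, smul_eq_mul,
    Complex.re_ofReal_mul, Complex.zero_re] at hnonneg
  have hVB : V * Kb * Vᴴ
      = V * W' * Matrix.diagonal (fun i => (β i : ℂ)) * (V * W')ᴴ := by
    rw [hKbW]
    simp only [Matrix.conjTranspose_mul, Matrix.mul_assoc]
  have hS := Matrix.normSq_mem_doublyStochastic (mul_mem hV hW')
  have hrev : Antivary lam (β ∘ Fin.rev) := fun i j hij => by
    refine hlam (le_of_not_gt fun hji => hij.not_ge ?_)
    exact hβ (Fin.rev_le_rev.2 hji.le)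
  have hlow : ∑ i, lam i * β i.rev ≤
      (Matrix.trace (Matrix.diagonal (fun i => (lam i : ℂ)) * (V * Kb * Vᴴ))).re := by
    rw [hVB, Matrix.trace_diagonal_mul_conj_diagonal]
    have hS' : (Matrix.of fun i j => Complex.normSq ((V * W') i j)).submatrix id Fin.rev
        ∈ doublyStochastic ℝ (Fin N) := by
      rw [mem_doublyStochastic_iff_sum] at hS ⊢
      refine ⟨fun i j => hS.1 _ _, fun i => ?_, fun j => hS.2.2 _⟩
      exact (Equiv.sum_comp Fin.revPerm _).trans (hS.2.1 i)
    refine (hrev.sum_mul_le_sum_sum_of_mem_doublyStochastic hS').trans_eq ?_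
    refine Finset.sum_congr rfl fun i _ => ?_
    exact Equiv.sum_comp Fin.revPerm fun j => lam i * Complex.normSq ((V * W') i j) * β j
  linarith [mul_le_mul_of_nonneg_left hlow hc0]
end

section
/- Let N ≥ 1, let K be an N×N complex Hermitian matrix, and let c ≥ 0 be such that K − c·I is positive semidefinite. Let λ : Fin N → ℝ satisfy λ_1 ≥ ⋯ ≥ λ_N ≥ 0 and set X = Λ^{1/2} · K · Λ^{1/2} with Λ^{1/2} = diag(√λ_1,…,√λ_N). Then for every k with 1 ≤ k ≤ N, the k-th largest eigenvalue of the Hermitian matrix X satisfies σ_k(X) ≥ c * λ_k. -/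
open Matrix
open scoped ComplexOrder

/-- The quadratic form of a real diagonal matrix. -/
lemma star_dotProduct_diagonal_mulVec {n : Type*} [Fintype n] [DecidableEq n]
    (d : n → ℝ) (y : n → ℂ) :
    star y ⬝ᵥ (diagonal (fun i => (d i : ℂ)) *ᵥ y) =
      ((∑ i, d i * Complex.normSq (y i) : ℝ) : ℂ) := by
  simp only [dotProduct, mulVec_diagonal, Pi.star_apply]
  push_cast
  refine Finset.sum_congr rfl fun i _ => ?_
  rw [Complex.normSq_eq_conj_mul_self, RCLike.star_def]
  ring

/-- Some nonzero vector vanishes above the index `k` while its image under `A` vanishes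
below `k`. -/
lemma exists_ne_zero_apply_eq_zero_mulVec_eq_zero {n F : Type*} [Fintype n] [LinearOrder n]
    [Field F] (A : Matrix n n F) (k : n) :
    ∃ x ≠ 0, (∀ j, k < j → x j = 0) ∧ ∀ i, i < k → (A *ᵥ x) i = 0 := by
  let T : Matrix n n F := of fun i => if i < k then A i else if k < i then Pi.single i 1 else 0
  have hT : T.det = 0 := det_eq_zero_of_row_eq_zero k fun j => by simp [T]
  obtain ⟨x, hx, hTx⟩ := exists_mulVec_eq_zero_iff.mpr hT
  refine ⟨x, hx, fun j hj => ?_, fun i hi => ?_⟩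
  · simpa [T, mulVec, hj, hj.not_gt] using congrFun hTx j
  · simpa [T, mulVec, hi] using congrFun hTx i

/-- Weyl monotonicity against a diagonal matrix: if `W diag(σ) Wᴴ - diag(μ)` is positive
semidefinite, with `W` unitary and `σ`, `μ` nonincreasing, then `μ ≤ σ`. -/
lemma le_of_posSemidef_sub_diagonal {n : Type*} [Fintype n] [LinearOrder n]
    {W : Matrix n n ℂ} (hW : W ∈ unitaryGroup n ℂ) {σ μ : n → ℝ}
    (hσ : Antitone σ) (hμ : Antitone μ)
    (h : (W * diagonal (fun i => (σ i : ℂ)) * Wᴴ - diagonal (fun i => (μ i : ℂ))).PosSemidef)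
    (k : n) : μ k ≤ σ k := by
  obtain ⟨x, hx, hxk, hyk⟩ := exists_ne_zero_apply_eq_zero_mulVec_eq_zero Wᴴ k
  set y := Wᴴ *ᵥ x with hy
  have hform : star x ⬝ᵥ ((W * diagonal (fun i => (σ i : ℂ)) * Wᴴ) *ᵥ x) =
      star y ⬝ᵥ (diagonal (fun i => (σ i : ℂ)) *ᵥ y) := by
    rw [hy, star_mulVec, conjTranspose_conjTranspose, ← dotProduct_mulVec, mulVec_mulVec,
      mulVec_mulVec]
  have hnorm : ∑ i, Complex.normSq (y i) = ∑ i, Complex.normSq (x i) := by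
    have hyx : star y ⬝ᵥ y = star x ⬝ᵥ x := by
      rw [hy, star_mulVec, conjTranspose_conjTranspose, ← dotProduct_mulVec, mulVec_mulVec,
        ← star_eq_conjTranspose, mem_unitaryGroup_iff.mp hW, one_mulVec]
    have hy1 := star_dotProduct_diagonal_mulVec (fun _ => 1) y
    have hx1 := star_dotProduct_diagonal_mulVec (fun _ => 1) x
    simp only [Complex.ofReal_one, diagonal_one, one_mulVec, one_mul] at hx1 hy1
    exact_mod_cast hy1.symm.trans (hyx.trans hx1)
  have hquad : ∑ i, μ i * Complex.normSq (x i) ≤ ∑ i, σ i * Complex.normSq (y i) := by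
    have h0 := h.dotProduct_mulVec_nonneg x
    rw [sub_mulVec, dotProduct_sub, hform, star_dotProduct_diagonal_mulVec,
      star_dotProduct_diagonal_mulVec, sub_nonneg] at h0
    exact_mod_cast h0
  have hlow : μ k * ∑ i, Complex.normSq (x i) ≤ ∑ i, μ i * Complex.normSq (x i) := by
    rw [Finset.mul_sum]
    refine Finset.sum_le_sum fun i _ => ?_
    rcases le_or_gt i k with hi | hi
    · exact mul_le_mul_of_nonneg_right (hμ hi) (Complex.normSq_nonneg _)
    · simp [hxk i hi]
  have hupp : ∑ i, σ i * Complex.normSq (y i) ≤ σ k * ∑ i, Complex.normSq (y i) := by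
    rw [Finset.mul_sum]
    refine Finset.sum_le_sum fun i _ => ?_
    rcases lt_or_ge i k with hi | hi
    · simp [hyk i hi]
    · exact mul_le_mul_of_nonneg_right (hσ hi) (Complex.normSq_nonneg _)
  have hpos : 0 < ∑ i, Complex.normSq (x i) := by
    obtain ⟨j, hj⟩ := Function.ne_iff.mp hx
    exact Finset.sum_pos' (fun i _ => Complex.normSq_nonneg _)
      ⟨j, Finset.mem_univ j, Complex.normSq_pos.mpr hj⟩
  rw [hnorm] at hupp
  exact le_of_mul_le_mul_right (hlow.trans (hquad.trans hupp)) hpos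

/-- eigenvalue domination (key step in the proof of Theorem 5,
Case 1): if `K - c·I` is positive semidefinite and
`X = Λ^{1/2} K Λ^{1/2}`, then the `k`-th largest eigenvalue of `X` satisfies
`σ_k(X) ≥ c λ_k`.  The hypothesis `hXσ` says that `σ` lists the eigenvalues of
`X` in nonincreasing order with multiplicity. -/
theorem stmt12 (N : ℕ) (hN : 1 ≤ N)
    (K : Matrix (Fin N) (Fin N) ℂ) (hK : K.IsHermitian)
    (c : ℝ) (hc : 0 ≤ c) (hKc : (K - c • (1 : Matrix (Fin N) (Fin N) ℂ)).PosSemidef)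
    (lam : Fin N → ℝ) (hlam : Antitone lam) (hlam0 : ∀ j, 0 ≤ lam j)
    (σ : Fin N → ℝ) (hσ : Antitone σ)
    (hXσ : ∃ W ∈ Matrix.unitaryGroup (Fin N) ℂ,
        Matrix.diagonal (fun i => (Real.sqrt (lam i) : ℂ)) * K *
            Matrix.diagonal (fun i => (Real.sqrt (lam i) : ℂ)) =
          W * Matrix.diagonal (fun i => (σ i : ℂ)) * Wᴴ) :
    ∀ k : Fin N, c * lam k ≤ σ k := by
  obtain ⟨W, hW, hX⟩ := hXσ
  refine le_of_posSemidef_sub_diagonal hW hσ (hlam.const_mul hc) ?_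
  have hD : (diagonal fun i => (Real.sqrt (lam i) : ℂ))ᴴ =
      diagonal fun i => (Real.sqrt (lam i) : ℂ) := by
    rw [diagonal_conjTranspose]
    congr 1
    ext i
    simp
  have hPSD := hKc.mul_mul_conjTranspose_same (diagonal fun i => (Real.sqrt (lam i) : ℂ))
  rw [hD, Matrix.mul_sub, Matrix.sub_mul, hX] at hPSD
  convert hPSD using 2
  rw [Matrix.mul_smul, Matrix.mul_one, Matrix.smul_mul, diagonal_mul_diagonal, ← diagonal_smul]
  congr 1
  ext i
  simp [← Complex.ofReal_mul, Real.mul_self_sqrt (hlam0 i)]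
end

section
/- Fix N ≥ 1, integers m, m' ≥ 1, and Kraus families A : Fin m → Matrix (Fin N) (Fin N) ℂ and B : Fin m' → Matrix (Fin N) (Fin N) ℂ with Σ_k (A k)† * (A k) = 1 and Σ_l (B l)† * (B l) = 1. Fix a real s with 0 ≤ s ≤ log N, and assume that J_min(K_φ, s) > 0 for every pair of unit vectors φ_a, φ_b ∈ ℂ^N. Define ε*(s) as the infimum of all ε ≥ 0 such that: for all finite types O_A, O_B, all POVMs (M_a)_{a ∈ O_A} and (M_b)_{b ∈ O_B} on ℂ^N, every subset T ⊆ O_A × O_B, and all ψ, ψ' ∈ ℍ_s, one has Σ_{(a,b) ∈ T} Re Tr((M_a ⊗ M_b) · ℰ(ρ_ψ)) ≤ exp(ε) * Σ_{(a,b) ∈ T} Re Tr((M_a ⊗ M_b) · ℰ(ρ_{ψ'})). Then ε*(s) = log( sup over unit vectors φ_a, φ_b ∈ ℂ^N of J_max(K_φ, s) / J_min(K_φ, s) ). -/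
open Matrix
open scoped ComplexOrder Kronecker

noncomputable section

/-- The density matrix `ρ_ψ = ψ ψ†` of a bipartite pure state. -/
def rhoPure (N : ℕ) (ψ : Fin N × Fin N → ℂ) :
    Matrix (Fin N × Fin N) (Fin N × Fin N) ℂ :=
  Matrix.of fun x y => ψ x * star (ψ y)

/-- The reduced matrix `ρ_A` of a bipartite pure state. -/
def rhoA (N : ℕ) (ψ : Fin N × Fin N → ℂ) : Matrix (Fin N) (Fin N) ℂ :=
  Matrix.of fun i i' => ∑ k, ψ (i, k) * star (ψ (i', k))

lemma rhoA_isHermitian (N : ℕ) (ψ : Fin N × Fin N → ℂ) :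
    (rhoA N ψ).IsHermitian := by
  unfold Matrix.IsHermitian
  ext i j
  simp [rhoA, Matrix.conjTranspose_apply, mul_comm]

/-- The entanglement entropy `E(ψ) = Σ_j negMulLog σ_j`, where `σ_j` are the
eigenvalues of the reduced matrix `ρ_A`. -/
def entEntropy (N : ℕ) (ψ : Fin N × Fin N → ℂ) : ℝ :=
  ∑ j, Real.negMulLog ((rhoA_isHermitian N ψ).eigenvalues j)

/-- `ℍ_s`: bipartite pure states (unit vectors) with entanglement entropy at
least `s`. -/
def Hset (N : ℕ) (s : ℝ) : Set (Fin N × Fin N → ℂ) :=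
  {ψ | (∑ x, ‖ψ x‖ ^ 2) = 1 ∧ s ≤ entEntropy N ψ}

/-- `Re ⟨ψ, K ψ⟩`. -/
def quadForm (N : ℕ) (K : Matrix (Fin N × Fin N) (Fin N × Fin N) ℂ)
    (ψ : Fin N × Fin N → ℂ) : ℝ :=
  (star ψ ⬝ᵥ K.mulVec ψ).re

/-- The product channel `ℰ(ρ) = Σ_{k,l} (A k ⊗ B l) ρ (A k ⊗ B l)†`. -/
def channel (N m m' : ℕ) (A : Fin m → Matrix (Fin N) (Fin N) ℂ)
    (B : Fin m' → Matrix (Fin N) (Fin N) ℂ)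
    (ρ : Matrix (Fin N × Fin N) (Fin N × Fin N) ℂ) :
    Matrix (Fin N × Fin N) (Fin N × Fin N) ℂ :=
  ∑ k, ∑ l, (A k ⊗ₖ B l) * ρ * (A k ⊗ₖ B l)ᴴ

/-- The induced observable
`K_φ = (Σ_k (A k)† (φ_a φ_a†) (A k)) ⊗ (Σ_l (B l)† (φ_b φ_b†) (B l))`. -/
def Kphi (N m m' : ℕ) (A : Fin m → Matrix (Fin N) (Fin N) ℂ)
    (B : Fin m' → Matrix (Fin N) (Fin N) ℂ) (φa φb : Fin N → ℂ) :
    Matrix (Fin N × Fin N) (Fin N × Fin N) ℂ :=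
  (∑ k, (A k)ᴴ * Matrix.vecMulVec φa (star φa) * A k) ⊗ₖ
    (∑ l, (B l)ᴴ * Matrix.vecMulVec φb (star φb) * B l)

/-- The maximal privacy energy `J_max(K, s) = sup {Re ⟨ψ, K ψ⟩ : ψ ∈ ℍ_s}`. -/
def Jmax (N : ℕ) (K : Matrix (Fin N × Fin N) (Fin N × Fin N) ℂ) (s : ℝ) : ℝ :=
  sSup {x : ℝ | ∃ ψ ∈ Hset N s, x = quadForm N K ψ}

/-- The minimal privacy energy `J_min(K, s) = inf {Re ⟨ψ, K ψ⟩ : ψ ∈ ℍ_s}`. -/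
def Jmin (N : ℕ) (K : Matrix (Fin N × Fin N) (Fin N × Fin N) ℂ) (s : ℝ) : ℝ :=
  sInf {x : ℝ | ∃ ψ ∈ Hset N s, x = quadForm N K ψ}

/-- The observable `Σ_{k,l} (A k ⊗ B l)† (X ⊗ Y) (A k ⊗ B l)` obtained from a local effect `X ⊗ Y`
in the Heisenberg picture. -/
def pulledEffect {N m m' : ℕ} (A : Fin m → Matrix (Fin N) (Fin N) ℂ)
    (B : Fin m' → Matrix (Fin N) (Fin N) ℂ) (X Y : Matrix (Fin N) (Fin N) ℂ) :
    Matrix (Fin N × Fin N) (Fin N × Fin N) ℂ :=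
  (∑ k, (A k)ᴴ * X * A k) ⊗ₖ (∑ l, (B l)ᴴ * Y * B l)

lemma rhoPure_eq_vecMulVec (N : ℕ) (ψ : Fin N × Fin N → ℂ) :
    rhoPure N ψ = Matrix.vecMulVec ψ (star ψ) := rfl

lemma sum_kronecker_sum {ι κ l m n p : Type*} [Fintype ι] [Fintype κ]
    (f : ι → Matrix l m ℂ) (g : κ → Matrix n p ℂ) :
    (∑ i, f i) ⊗ₖ (∑ j, g j) = ∑ i, ∑ j, f i ⊗ₖ g j := by
  ext x y
  simp [Matrix.kroneckerMap_apply, Matrix.sum_apply, Finset.sum_mul_sum]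

lemma trace_mul_channel {N m m' : ℕ} (A : Fin m → Matrix (Fin N) (Fin N) ℂ)
    (B : Fin m' → Matrix (Fin N) (Fin N) ℂ) (X Y : Matrix (Fin N) (Fin N) ℂ)
    (ψ : Fin N × Fin N → ℂ) :
    (Matrix.trace ((X ⊗ₖ Y) * channel N m m' A B (rhoPure N ψ))).re =
      quadForm N (pulledEffect A B X Y) ψ := by
  have h : Matrix.trace ((X ⊗ₖ Y) * channel N m m' A B (rhoPure N ψ)) =
      Matrix.trace (pulledEffect A B X Y * rhoPure N ψ) := by
    simp only [pulledEffect, channel, sum_kronecker_sum, Finset.mul_sum, Finset.sum_mul,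
      Matrix.trace_sum]
    refine Finset.sum_congr rfl fun k _ => Finset.sum_congr rfl fun l _ => ?_
    rw [Matrix.mul_kronecker_mul, Matrix.mul_kronecker_mul, ← Matrix.conjTranspose_kronecker,
      ← Matrix.mul_assoc, Matrix.trace_mul_comm]
    simp only [Matrix.mul_assoc]
  rw [h, rhoPure_eq_vecMulVec, Matrix.mul_vecMulVec, Matrix.trace_vecMulVec, quadForm,
    dotProduct_comm]

lemma quadForm_sum_smul {N : ℕ} {ι : Type*} (t : Finset ι) (c : ι → ℝ)
    (K : ι → Matrix (Fin N × Fin N) (Fin N × Fin N) ℂ) (ψ : Fin N × Fin N → ℂ) :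
    quadForm N (∑ i ∈ t, (c i : ℂ) • K i) ψ = ∑ i ∈ t, c i * quadForm N (K i) ψ := by
  simp [quadForm, Matrix.sum_mulVec, Matrix.smul_mulVec, dotProduct_sum, dotProduct_smul]

lemma Matrix.PosSemidef.exists_eq_sum_smul_vecMulVec {N : ℕ} {M : Matrix (Fin N) (Fin N) ℂ}
    (hM : M.PosSemidef) :
    ∃ (c : Fin N → ℝ) (u : Fin N → Fin N → ℂ), (∀ i, 0 ≤ c i) ∧ (∀ i, ∑ j, ‖u i j‖ ^ 2 = 1) ∧
      M = ∑ i, (c i : ℂ) • Matrix.vecMulVec (u i) (star (u i)) := by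
  refine ⟨hM.1.eigenvalues, fun i => hM.1.eigenvectorBasis i, hM.eigenvalues_nonneg,
    fun i => ?_, ?_⟩
  · rw [← EuclideanSpace.norm_sq_eq, hM.1.eigenvectorBasis.norm_eq_one, one_pow]
  · have h := hM.1.spectral_theorem
    rw [Unitary.conjStarAlgAut_apply] at h
    nth_rewrite 1 [h]
    ext x y
    simp [Matrix.mul_apply, Matrix.sum_apply, Matrix.vecMulVec_apply, Matrix.diagonal_apply,
      Matrix.star_apply, Matrix.IsHermitian.eigenvectorUnitary_apply]
    refine Finset.sum_congr rfl fun i _ => ?_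
    ring

lemma sum_conj_sum_smul {N n : ℕ} {ι : Type*} [Fintype ι] (C : Fin n → Matrix (Fin N) (Fin N) ℂ)
    (e : ι → ℝ) (Z : ι → Matrix (Fin N) (Fin N) ℂ) :
    ∑ k, (C k)ᴴ * (∑ i, (e i : ℂ) • Z i) * C k =
      ∑ i, (e i : ℂ) • ∑ k, (C k)ᴴ * Z i * C k := by
  simp only [Finset.mul_sum, Finset.sum_mul, Finset.smul_sum, mul_smul_comm, smul_mul_assoc]
  exact Finset.sum_comm

lemma pulledEffect_sum_smul {N m m' : ℕ} (A : Fin m → Matrix (Fin N) (Fin N) ℂ)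
    (B : Fin m' → Matrix (Fin N) (Fin N) ℂ) {ι κ : Type*} [Fintype ι] [Fintype κ]
    (c : ι → ℝ) (d : κ → ℝ) (X : ι → Matrix (Fin N) (Fin N) ℂ)
    (Y : κ → Matrix (Fin N) (Fin N) ℂ) :
    pulledEffect A B (∑ i, (c i : ℂ) • X i) (∑ j, (d j : ℂ) • Y j) =
      ∑ p : ι × κ, ((c p.1 * d p.2 : ℝ) : ℂ) • pulledEffect A B (X p.1) (Y p.2) := by
  rw [pulledEffect, sum_conj_sum_smul, sum_conj_sum_smul, sum_kronecker_sum, Fintype.sum_prod_type]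
  simp only [pulledEffect, Matrix.smul_kronecker, Matrix.kronecker_smul, smul_smul,
    Complex.ofReal_mul, mul_comm]

lemma exists_abs_quadForm_le {N : ℕ} (K : Matrix (Fin N × Fin N) (Fin N × Fin N) ℂ) (s : ℝ) :
    ∃ C : ℝ, ∀ ψ ∈ Hset N s, |quadForm N K ψ| ≤ C := by
  refine ⟨∑ x, ∑ y, ‖K x y‖, fun ψ hψ => ?_⟩
  have h1 (x) : ‖ψ x‖ ≤ 1 := by
    have := Finset.single_le_sum (f := fun x => ‖ψ x‖ ^ 2) (fun i _ => sq_nonneg _)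
      (Finset.mem_univ x)
    rw [hψ.1] at this
    exact (sq_le_one_iff₀ (norm_nonneg _)).1 this
  refine (Complex.abs_re_le_norm _).trans ?_
  simp only [dotProduct, Matrix.mulVec, Finset.mul_sum]
  refine (norm_sum_le _ _).trans (Finset.sum_le_sum fun x _ => ?_)
  refine (norm_sum_le _ _).trans (Finset.sum_le_sum fun y _ => ?_)
  rw [norm_mul, norm_mul, Pi.star_apply, norm_star]
  calc ‖ψ x‖ * (‖K x y‖ * ‖ψ y‖) ≤ 1 * (‖K x y‖ * 1) := by gcongr <;> exact h1 _
    _ = ‖K x y‖ := by ring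

lemma quadForm_le_Jmax {N : ℕ} (K : Matrix (Fin N × Fin N) (Fin N × Fin N) ℂ) {s : ℝ}
    {ψ : Fin N × Fin N → ℂ} (hψ : ψ ∈ Hset N s) : quadForm N K ψ ≤ Jmax N K s := by
  obtain ⟨C, hC⟩ := exists_abs_quadForm_le K s
  refine le_csSup ⟨C, ?_⟩ ⟨ψ, hψ, rfl⟩
  rintro _ ⟨χ, hχ, rfl⟩
  exact (abs_le.1 (hC χ hχ)).2

lemma Jmin_le_quadForm {N : ℕ} (K : Matrix (Fin N × Fin N) (Fin N × Fin N) ℂ) {s : ℝ}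
    {ψ : Fin N × Fin N → ℂ} (hψ : ψ ∈ Hset N s) : Jmin N K s ≤ quadForm N K ψ := by
  obtain ⟨C, hC⟩ := exists_abs_quadForm_le K s
  refine csInf_le ⟨-C, ?_⟩ ⟨ψ, hψ, rfl⟩
  rintro _ ⟨χ, hχ, rfl⟩
  exact (abs_le.1 (hC χ hχ)).1

lemma Jmax_le_mul_Jmin {N : ℕ} (K : Matrix (Fin N × Fin N) (Fin N × Fin N) ℂ) {s c : ℝ}
    (hc : 0 < c) (hne : (Hset N s).Nonempty)
    (h : ∀ ψ ∈ Hset N s, ∀ ψ' ∈ Hset N s, quadForm N K ψ ≤ c * quadForm N K ψ') :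
    Jmax N K s ≤ c * Jmin N K s := by
  obtain ⟨χ, hχ⟩ := hne
  refine csSup_le ⟨_, χ, hχ, rfl⟩ ?_
  rintro _ ⟨ψ, hψ, rfl⟩
  rw [← div_le_iff₀' hc]
  refine le_csInf ⟨_, χ, hχ, rfl⟩ ?_
  rintro _ ⟨ψ', hψ', rfl⟩
  rw [div_le_iff₀' hc]
  exact h ψ hψ ψ' hψ'

/-- The two-outcome projective measurement onto a vector and its orthogonal complement. -/
def binaryMeasurement {N : ℕ} (φ : Fin N → ℂ) (b : Bool) : Matrix (Fin N) (Fin N) ℂ :=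
  if b then Matrix.vecMulVec φ (star φ) else 1 - Matrix.vecMulVec φ (star φ)

lemma sum_binaryMeasurement {N : ℕ} (φ : Fin N → ℂ) : ∑ b, binaryMeasurement φ b = 1 := by
  simp [binaryMeasurement]

lemma binaryMeasurement_posSemidef {N : ℕ} {φ : Fin N → ℂ} (hφ : ∑ i, ‖φ i‖ ^ 2 = 1)
    (b : Bool) : (binaryMeasurement φ b).PosSemidef := by
  set P := Matrix.vecMulVec φ (star φ) with hP
  have hherm : Pᴴ = P := by rw [hP, Matrix.conjTranspose_vecMulVec, star_star]
  have hdot : star φ ⬝ᵥ φ = 1 := by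
    have h : star φ ⬝ᵥ φ = ((∑ i, ‖φ i‖ ^ 2 : ℝ) : ℂ) := by
      simp [dotProduct, Complex.conj_mul']
    rw [h, hφ, Complex.ofReal_one]
  have hidem : P * P = P := by
    rw [hP, Matrix.vecMulVec_mul_vecMulVec, hdot, one_smul]
  cases b
  · have h : binaryMeasurement φ false = (1 - P)ᴴ * (1 - P) := by
      simp [binaryMeasurement, ← hP, hherm, sub_mul, mul_sub, hidem]
    rw [h]
    exact Matrix.posSemidef_conjTranspose_mul_self _
  · simpa [binaryMeasurement] using Matrix.posSemidef_vecMulVec_self_star φ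

lemma quadForm_pulledEffect_le {N m m' : ℕ} {A : Fin m → Matrix (Fin N) (Fin N) ℂ}
    {B : Fin m' → Matrix (Fin N) (Fin N) ℂ} {X Y : Matrix (Fin N) (Fin N) ℂ}
    (hX : X.PosSemidef) (hY : Y.PosSemidef) {c : ℝ} {ψ ψ' : Fin N × Fin N → ℂ}
    (h : ∀ φa φb : Fin N → ℂ, ∑ i, ‖φa i‖ ^ 2 = 1 → ∑ i, ‖φb i‖ ^ 2 = 1 →
      quadForm N (Kphi N m m' A B φa φb) ψ ≤ c * quadForm N (Kphi N m m' A B φa φb) ψ') :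
    quadForm N (pulledEffect A B X Y) ψ ≤ c * quadForm N (pulledEffect A B X Y) ψ' := by
  obtain ⟨p, u, hp, hu, rfl⟩ := hX.exists_eq_sum_smul_vecMulVec
  obtain ⟨q, v, hq, hv, rfl⟩ := hY.exists_eq_sum_smul_vecMulVec
  rw [pulledEffect_sum_smul, quadForm_sum_smul, quadForm_sum_smul, Finset.mul_sum]
  refine Finset.sum_le_sum fun i _ => ?_
  rw [mul_left_comm]
  exact mul_le_mul_of_nonneg_left (h _ _ (hu i.1) (hv i.2)) (mul_nonneg (hp _) (hq _))

/-- Theorem 2 of the paper, Optimal Privacy Budget: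
the optimal entanglement-constrained QLDP leakage level of a product channel
against local measurement adversaries equals
`log sup_{φ_a, φ_b} J_max(K_φ, s) / J_min(K_φ, s)`. -/
theorem stmt14 (N m m' : ℕ) (hN : 1 ≤ N) (hm : 1 ≤ m) (hm' : 1 ≤ m')
    (A : Fin m → Matrix (Fin N) (Fin N) ℂ) (B : Fin m' → Matrix (Fin N) (Fin N) ℂ)
    (hA : (∑ k, (A k)ᴴ * A k) = 1) (hB : (∑ l, (B l)ᴴ * B l) = 1)
    (s : ℝ) (hs0 : 0 ≤ s) (hs1 : s ≤ Real.log N)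
    (hpos : ∀ φa φb : Fin N → ℂ, (∑ i, ‖φa i‖ ^ 2) = 1 → (∑ i, ‖φb i‖ ^ 2) = 1 →
      0 < Jmin N (Kphi N m m' A B φa φb) s) :
    sInf {ε : ℝ | 0 ≤ ε ∧
        ∀ (OA OB : Type) (_ : Fintype OA) (_ : Fintype OB)
          (MA : OA → Matrix (Fin N) (Fin N) ℂ)
          (MB : OB → Matrix (Fin N) (Fin N) ℂ),
          (∀ a, (MA a).PosSemidef) → (∀ b, (MB b).PosSemidef) →
          (∑ a, MA a) = 1 → (∑ b, MB b) = 1 →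
          ∀ T : Finset (OA × OB), ∀ ψ ∈ Hset N s, ∀ ψ' ∈ Hset N s,
            (∑ ab ∈ T, (Matrix.trace
                ((MA ab.1 ⊗ₖ MB ab.2) * channel N m m' A B (rhoPure N ψ))).re) ≤
              Real.exp ε * ∑ ab ∈ T, (Matrix.trace
                ((MA ab.1 ⊗ₖ MB ab.2) * channel N m m' A B (rhoPure N ψ'))).re} =
      Real.log (sSup {r : ℝ | ∃ φa φb : Fin N → ℂ,
        (∑ i, ‖φa i‖ ^ 2) = 1 ∧ (∑ i, ‖φb i‖ ^ 2) = 1 ∧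
        r = Jmax N (Kphi N m m' A B φa φb) s / Jmin N (Kphi N m m' A B φa φb) s}) := by
  simp only [trace_mul_channel]
  set R := {r : ℝ | ∃ φa φb : Fin N → ℂ,
    (∑ i, ‖φa i‖ ^ 2) = 1 ∧ (∑ i, ‖φb i‖ ^ 2) = 1 ∧
    r = Jmax N (Kphi N m m' A B φa φb) s / Jmin N (Kphi N m m' A B φa φb) s} with hR
  obtain ⟨φ, hφ⟩ : ∃ φ : Fin N → ℂ, ∑ i, ‖φ i‖ ^ 2 = 1 := by
    refine ⟨Pi.single ⟨0, hN⟩ 1, ?_⟩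
    rw [Finset.sum_eq_single ⟨0, hN⟩] <;> simp +contextual
  have hne : (Hset N s).Nonempty := by
    by_contra hempty
    rw [Set.not_nonempty_iff_eq_empty] at hempty
    have := hpos φ φ hφ hφ
    simp [Jmin, hempty] at this
  set S := {ε : ℝ | _ } with hS
  have hRne : R.Nonempty := ⟨_, φ, φ, hφ, hφ, rfl⟩
  have hSR : ∀ ε ∈ S, ∀ r ∈ R, r ≤ Real.exp ε := by
    rintro ε ⟨-, hε⟩ _ ⟨φa, φb, ha, hb, rfl⟩
    rw [div_le_iff₀ (hpos φa φb ha hb)]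
    refine Jmax_le_mul_Jmin _ (Real.exp_pos ε) hne fun ψ hψ ψ' hψ' => ?_
    have h := hε Bool Bool inferInstance inferInstance
      (binaryMeasurement φa) (binaryMeasurement φb) (binaryMeasurement_posSemidef ha)
      (binaryMeasurement_posSemidef hb) (sum_binaryMeasurement φa) (sum_binaryMeasurement φb)
      {(true, true)} ψ hψ ψ' hψ'
    rw [Finset.sum_singleton, Finset.sum_singleton] at h
    exact h
  by_cases hbdd : BddAbove R
  · have hone : 1 ≤ sSup R := by
      refine le_csSup_of_le hbdd ⟨φ, φ, hφ, hφ, rfl⟩ ?_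
      rw [one_le_div (hpos φ φ hφ hφ)]
      obtain ⟨χ, hχ⟩ := hne
      exact (Jmin_le_quadForm _ hχ).trans (quadForm_le_Jmax _ hχ)
    have hCpos : 0 < sSup R := one_pos.trans_le hone
    refine IsLeast.csInf_eq ⟨⟨Real.log_nonneg hone, ?_⟩, fun ε hε => ?_⟩
    · intro OA OB _ _ MA MB hMA hMB _ _ T ψ hψ ψ' hψ'
      rw [Real.exp_log hCpos, Finset.mul_sum]
      refine Finset.sum_le_sum fun ab _ => quadForm_pulledEffect_le (hMA _) (hMB _) ?_
      intro φa φb ha hb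
      have hr := le_csSup hbdd ⟨φa, φb, ha, hb, rfl⟩
      rw [div_le_iff₀ (hpos φa φb ha hb)] at hr
      calc _ ≤ _ := quadForm_le_Jmax _ hψ
        _ ≤ _ := hr
        _ ≤ _ := mul_le_mul_of_nonneg_left (Jmin_le_quadForm _ hψ') hCpos.le
    · exact (Real.log_le_iff_le_exp hCpos).2 (csSup_le hRne (hSR ε hε))
  · have hSempty : S = ∅ :=
      Set.eq_empty_of_forall_notMem fun ε hε => hbdd ⟨_, fun r hr => hSR ε hε r hr⟩
    rw [hSempty, Real.sInf_empty, Real.sSup_of_not_bddAbove hbdd, Real.log_zero]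
end
end

section
/- Define v : ℝ → ℝ by v(t) = t/4 + 1/8 and w : ℝ → ℝ by w(t) = 3/8 − t/4. Then for all p, q ∈ [1/2, 1], one has v(p) * v(q) ≤ 9 * w(p) * w(q), with equality when p = q = 1. Consequently, since w(p) > 0 and w(q) > 0 on [1/2,1], log( v(p)v(q) / (w(p)w(q)) ) ≤ 2 * log 3. -/
noncomputable section

/-- The larger eigenvalue `v(t) = t/4 + 1/8` of `𝒩_{1/2}†` on a rank-one
projector with even-parity weight `t`. -/
def v (t : ℝ) : ℝ := t / 4 + 1 / 8

/-- The smaller eigenvalue `w(t) = 3/8 - t/4`. -/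
def w (t : ℝ) : ℝ := 3 / 8 - t / 4

theorem v_pos {t : ℝ} (ht : t ∈ Set.Icc (1/2 : ℝ) 1) : 0 < v t := by
  obtain ⟨h, -⟩ := ht
  unfold v
  linarith

theorem w_pos {t : ℝ} (ht : t ∈ Set.Icc (1/2 : ℝ) 1) : 0 < w t := by
  obtain ⟨-, h⟩ := ht
  unfold w
  linarith

theorem v_le_three_mul_w {t : ℝ} (ht : t ∈ Set.Icc (1/2 : ℝ) 1) : v t ≤ 3 * w t := by
  obtain ⟨-, h⟩ := ht
  unfold v w
  linarith

theorem v_mul_v_le {p q : ℝ} (hp : p ∈ Set.Icc (1/2 : ℝ) 1) (hq : q ∈ Set.Icc (1/2 : ℝ) 1) :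
    v p * v q ≤ 9 * w p * w q :=
  calc v p * v q ≤ (3 * w p) * (3 * w q) :=
        mul_le_mul (v_le_three_mul_w hp) (v_le_three_mul_w hq) (v_pos hq).le
          (mul_pos three_pos (w_pos hp)).le
    _ = 9 * w p * w q := by ring

/-- low-entanglement bound of Proposition 1: for
`p, q ∈ [1/2, 1]`, `v(p)v(q) ≤ 9 w(p)w(q)`, with equality at `p = q = 1`;
since `w > 0` on `[1/2, 1]`, `log(v(p)v(q)/(w(p)w(q))) ≤ 2 log 3`. -/
theorem stmt16 :
    (∀ p ∈ Set.Icc (1/2 : ℝ) 1, ∀ q ∈ Set.Icc (1/2 : ℝ) 1,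
      v p * v q ≤ 9 * w p * w q) ∧
    v 1 * v 1 = 9 * w 1 * w 1 ∧
    (∀ p ∈ Set.Icc (1/2 : ℝ) 1, 0 < w p) ∧
    (∀ p ∈ Set.Icc (1/2 : ℝ) 1, ∀ q ∈ Set.Icc (1/2 : ℝ) 1,
      Real.log (v p * v q / (w p * w q)) ≤ 2 * Real.log 3) := by
  refine ⟨fun p hp q hq => v_mul_v_le hp hq, by norm_num [v, w], fun p hp => w_pos hp,
    fun p hp q hq => ?_⟩
  have hw : 0 < w p * w q := mul_pos (w_pos hp) (w_pos hq)
  have hlog : 2 * Real.log 3 = Real.log (3 ^ 2) := by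
    rw [Real.log_pow]
    norm_num
  rw [hlog]
  refine Real.log_le_log (div_pos (mul_pos (v_pos hp) (v_pos hq)) hw) ?_
  rw [div_le_iff₀ hw]
  linarith [v_mul_v_le hp hq]
end
end

section
/- Define v : ℝ → ℝ by v(t) = t/4 + 1/8 and w : ℝ → ℝ by w(t) = 3/8 − t/4. Then for all τ ∈ [1/2, 1] and all p, q ∈ [1/2, 1], one has (3 − 2τ) * ( τ * v(p) * v(q) + (1 − τ) * w(p) * w(q) ) ≤ (8τ + 1) * ( (1 − τ) * v(p) * w(q) + τ * w(p) * w(q) ), with equality when p = q = 1. -/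
noncomputable section

/-- high-entanglement bound of Proposition 1: for
`τ, p, q ∈ [1/2, 1]`,
`(3 - 2τ)(τ v(p)v(q) + (1-τ) w(p)w(q)) ≤ (8τ+1)((1-τ) v(p)w(q) + τ w(p)w(q))`,
with equality at `p = q = 1`. -/
theorem stmt17 :
    (∀ τ ∈ Set.Icc (1/2 : ℝ) 1, ∀ p ∈ Set.Icc (1/2 : ℝ) 1,
      ∀ q ∈ Set.Icc (1/2 : ℝ) 1,
      (3 - 2 * τ) * (τ * v p * v q + (1 - τ) * w p * w q) ≤
        (8 * τ + 1) * ((1 - τ) * v p * w q + τ * w p * w q)) ∧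
    (∀ τ ∈ Set.Icc (1/2 : ℝ) 1,
      (3 - 2 * τ) * (τ * v 1 * v 1 + (1 - τ) * w 1 * w 1) =
        (8 * τ + 1) * ((1 - τ) * v 1 * w 1 + τ * w 1 * w 1)) := by
  refine ⟨?_, fun τ _ => by unfold v w; ring⟩
  rintro τ ⟨hτ, hτ'⟩ p ⟨hp, hp'⟩ q ⟨hq, hq'⟩
  -- The difference is bilinear in `(p, q)`; it is nonnegative at each vertex of the square.
  have hpq : 0 ≤ (2 - 2 * p) * (2 * q - 1) * (8 * τ ^ 2 + 8 * τ - 4) :=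
    mul_nonneg (mul_nonneg (by linarith) (by linarith)) (by nlinarith)
  have hqp : 0 ≤ (2 * p - 1) * (2 - 2 * q) * (12 * τ * (3 - 2 * τ)) :=
    mul_nonneg (mul_nonneg (by linarith) (by linarith))
      (mul_nonneg (by linarith) (by linarith))
  have hhalf : 0 ≤ (2 - 2 * p) * (2 - 2 * q) * (4 * (10 * τ - 2)) :=
    mul_nonneg (mul_nonneg (by linarith) (by linarith)) (by linarith)
  unfold v w
  linarith
end
end

section
/- Define v : ℝ → ℝ by v(t) = t/4 + 1/8 and w : ℝ → ℝ by w(t) = 3/8 − t/4. Then for all τ ∈ [1/2, 1] and all p, q ∈ [1/2, 1], one has (1 − τ) * ( τ * (p/2) * v(q) + (1 − τ) * ((1 − p)/2) * w(q) ) ≤ 3τ * ( (1 − τ) * (p/2) * w(q) + τ * ((1 − p)/2) * w(q) ), with equality when p = q = 1. -/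
noncomputable section

/-- high-entanglement bound of Proposition 2: for
`τ, p, q ∈ [1/2, 1]`,
`(1-τ)(τ (p/2) v(q) + (1-τ)((1-p)/2) w(q)) ≤ 3τ((1-τ)(p/2) w(q) + τ((1-p)/2) w(q))`,
with equality at `p = q = 1`. -/
theorem stmt18 :
    (∀ τ ∈ Set.Icc (1/2 : ℝ) 1, ∀ p ∈ Set.Icc (1/2 : ℝ) 1,
      ∀ q ∈ Set.Icc (1/2 : ℝ) 1,
      (1 - τ) * (τ * (p / 2) * v q + (1 - τ) * ((1 - p) / 2) * w q) ≤
        3 * τ * ((1 - τ) * (p / 2) * w q + τ * ((1 - p) / 2) * w q)) ∧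
    (∀ τ ∈ Set.Icc (1/2 : ℝ) 1,
      (1 - τ) * (τ * ((1 : ℝ) / 2) * v 1 + (1 - τ) * ((1 - (1 : ℝ)) / 2) * w 1) =
        3 * τ * ((1 - τ) * ((1 : ℝ) / 2) * w 1 + τ * ((1 - (1 : ℝ)) / 2) * w 1)) := by
  constructor
  · rintro τ ⟨hτ, hτ'⟩ p ⟨hp, hp'⟩ q ⟨-, hq⟩
    have hw : 0 ≤ w q := by unfold w; linarith
    have hvw : 0 ≤ 3 * w q - v q := by unfold v w; linarith
    have hcoef : 0 ≤ 3 * τ ^ 2 - (1 - τ) ^ 2 := by nlinarith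
    have h₁ : 0 ≤ (1 - τ) * τ * (p / 2) * (3 * w q - v q) :=
      mul_nonneg (mul_nonneg (mul_nonneg (by linarith) (by linarith)) (by linarith)) hvw
    have h₂ : 0 ≤ (1 - p) / 2 * w q * (3 * τ ^ 2 - (1 - τ) ^ 2) :=
      mul_nonneg (mul_nonneg (by linarith) hw) hcoef
    linarith
  · intro τ _
    unfold v w
    ring
end
end
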